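/- arXiv:1407.1353 — 10 statements merged into one kernel-verified Lean document; each statement's English description precedes it below -/
import Mathlib

section
/- Let X be a finite-dimensional real normed linear space of dimension at least 2. Then the rectangular constant of X is attained: there exist nonzero x₀, y₀ ∈ X with x₀ ⊥_B y₀ such that for all nonzero x, y ∈ X with x ⊥_B y, one has (‖x‖ + ‖y‖)/‖x + y‖ ≤ (‖x₀‖ + ‖y₀‖)/‖x₀ + y₀‖. -/
/-- A real normed space of finite dimension at least 2 contains a nonzero pair which is
Birkhoff-James orthogonal. -/
theorem exists_ne_zero_birkhoff_orthogonal {X : Type*} [NormedAddCommGroup X] [NormedSpace ℝ X]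
    [FiniteDimensional ℝ X] (hdim : 2 ≤ Module.finrank ℝ X) :
    ∃ x y : X, x ≠ 0 ∧ y ≠ 0 ∧ ∀ lam : ℝ, ‖x‖ ≤ ‖x + lam • y‖ := by
  have : Nontrivial X := Module.nontrivial_of_finrank_pos (R := ℝ) (by omega)
  obtain ⟨x, hx⟩ := exists_ne (0 : X)
  obtain ⟨g, hg, hgx⟩ := exists_dual_vector ℝ x (norm_ne_zero_iff.2 hx)
  have hker : LinearMap.ker (g : X →ₗ[ℝ] ℝ) ≠ ⊥ :=
    LinearMap.ker_ne_bot_of_finrank_lt (by rw [Module.finrank_self]; omega)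
  obtain ⟨y, hy, hy0⟩ := Submodule.exists_mem_ne_zero_of_ne_bot hker
  refine ⟨x, y, hx, hy0, fun lam => ?_⟩
  have hgy : g y = 0 := by simpa using hy
  have h := g.le_opNorm (x + lam • y)
  simpa [hg, hgx, hgy] using h

/-- In a finite-dimensional real normed space, `‖x + y‖` attains its minimum over the
Birkhoff-James orthogonal pairs normalized by `‖x‖ + ‖y‖ = 1`. -/
theorem exists_min_norm_add_of_birkhoff_orthogonal {X : Type*} [NormedAddCommGroup X]
    [NormedSpace ℝ X] [FiniteDimensional ℝ X] [Nontrivial X] :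
    ∃ x₀ y₀ : X, ‖x₀‖ + ‖y₀‖ = 1 ∧ (∀ lam : ℝ, ‖x₀‖ ≤ ‖x₀ + lam • y₀‖) ∧
      ∀ x y : X, ‖x‖ + ‖y‖ = 1 → (∀ lam : ℝ, ‖x‖ ≤ ‖x + lam • y‖) →
        ‖x₀ + y₀‖ ≤ ‖x + y‖ := by
  have : ProperSpace X := FiniteDimensional.proper ℝ X
  let K : Set (X × X) :=
    {p | ‖p.1‖ + ‖p.2‖ = 1} ∩ {p | ∀ lam : ℝ, ‖p.1‖ ≤ ‖p.1 + lam • p.2‖}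
  have hK : IsCompact K := by
    refine (isCompact_closedBall (0 : X × X) 1).of_isClosed_subset
      ((isClosed_eq (by fun_prop) (by fun_prop)).inter ?_) ?_
    · rw [Set.ofPred_forall]
      exact isClosed_iInter fun lam => isClosed_le (by fun_prop) (by fun_prop)
    · rintro p ⟨hp, -⟩
      have hp : ‖p.1‖ + ‖p.2‖ = 1 := hp
      rw [mem_closedBall_zero_iff, Prod.norm_def]
      exact max_le (by linarith [norm_nonneg p.2]) (by linarith [norm_nonneg p.1])
  have hne : K.Nonempty := by
    obtain ⟨u, hu⟩ := exists_norm_eq X zero_le_one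
    exact ⟨(u, 0), by simp [hu], by simp⟩
  obtain ⟨⟨x₀, y₀⟩, ⟨hn, ho⟩, hmin⟩ := hK.exists_isMinOn hne
    (f := fun p : X × X => ‖p.1 + p.2‖) (by fun_prop)
  exact ⟨x₀, y₀, hn, ho, fun x y hxy hort => hmin (a := (x, y)) ⟨hxy, hort⟩⟩

/-- In a finite-dimensional real normed space of dimension at least 2,
the rectangular constant is attained. -/
theorem stmt_1 {X : Type*} [NormedAddCommGroup X] [NormedSpace ℝ X]
    [FiniteDimensional ℝ X] (hdim : 2 ≤ Module.finrank ℝ X) :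
    ∃ x₀ y₀ : X, x₀ ≠ 0 ∧ y₀ ≠ 0 ∧ (∀ lam : ℝ, ‖x₀‖ ≤ ‖x₀ + lam • y₀‖) ∧
      ∀ x y : X, x ≠ 0 → y ≠ 0 → (∀ lam : ℝ, ‖x‖ ≤ ‖x + lam • y‖) →
        (‖x‖ + ‖y‖) / ‖x + y‖ ≤ (‖x₀‖ + ‖y₀‖) / ‖x₀ + y₀‖ := by
  have : Nontrivial X := Module.nontrivial_of_finrank_pos (R := ℝ) (by omega)
  have add_pos_of_orth : ∀ x y : X, x ≠ 0 → (∀ lam : ℝ, ‖x‖ ≤ ‖x + lam • y‖) →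
      0 < ‖x + y‖ := fun x y hx h =>
    (norm_pos_iff.2 hx).trans_le (by simpa using h 1)
  obtain ⟨x₀, y₀, hn, ho, hmin⟩ := exists_min_norm_add_of_birkhoff_orthogonal (X := X)
  have hscale : ∀ x y : X, x ≠ 0 → (∀ lam : ℝ, ‖x‖ ≤ ‖x + lam • y‖) →
      ‖x₀ + y₀‖ * (‖x‖ + ‖y‖) ≤ ‖x + y‖ := by
    intro x y hx h
    have hs : 0 < ‖x‖ + ‖y‖ := add_pos_of_pos_of_nonneg (norm_pos_iff.2 hx) (norm_nonneg y)
    set s := ‖x‖ + ‖y‖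
    have hs' : ‖s⁻¹‖ = s⁻¹ := Real.norm_of_nonneg (inv_nonneg.2 hs.le)
    have key := hmin (s⁻¹ • x) (s⁻¹ • y)
      (by rw [norm_smul, norm_smul, hs', ← mul_add]; exact inv_mul_cancel₀ hs.ne')
      (fun lam => by
        rw [smul_comm lam, ← smul_add, norm_smul, norm_smul]
        exact mul_le_mul_of_nonneg_left (h lam) (norm_nonneg _))
    rw [← smul_add, norm_smul, hs', inv_mul_eq_div, le_div_iff₀ hs] at key
    exact key
  by_cases hz : x₀ = 0 ∨ y₀ = 0
  · have hone : ‖x₀ + y₀‖ = 1 := by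
      rcases hz with rfl | rfl <;> simpa using hn
    obtain ⟨u, v, hu, hv, huv⟩ := exists_ne_zero_birkhoff_orthogonal hdim
    refine ⟨u, v, hu, hv, huv, fun x y hx _ h => ?_⟩
    have hxy := hscale x y hx h
    rw [hone, one_mul] at hxy
    calc (‖x‖ + ‖y‖) / ‖x + y‖ ≤ 1 := div_le_one_of_le₀ hxy (norm_nonneg _)
      _ ≤ (‖u‖ + ‖v‖) / ‖u + v‖ :=
        (one_le_div (add_pos_of_orth u v hu huv)).2 (norm_add_le u v)
  · obtain ⟨hx₀, hy₀⟩ := not_or.1 hz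
    refine ⟨x₀, y₀, hx₀, hy₀, ho, fun x y hx _ h => ?_⟩
    rw [hn, div_le_div_iff₀ (add_pos_of_orth x y hx h) (add_pos_of_orth x₀ y₀ hx₀ ho), one_mul,
      mul_comm]
    exact hscale x y hx h
end

section
/- Let X be a real normed linear space and let l be a real number such that ‖u − v‖ < l for all unit vectors u, v ∈ X satisfying ‖t·u + (1−t)·v‖ = 1 for every t ∈ [0,1]. Then for any unit vectors x, y ∈ X with x ⊥_B y, one has ‖x + λ·y‖ > 1 for every real λ with |λ| ≥ l. -/
theorem stmt_2 {X : Type*} [NormedAddCommGroup X] [NormedSpace ℝ X] (l : ℝ)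
    (h : ∀ u v : X, ‖u‖ = 1 → ‖v‖ = 1 →
      (∀ t : ℝ, t ∈ Set.Icc (0 : ℝ) 1 → ‖t • u + (1 - t) • v‖ = 1) → ‖u - v‖ < l) :
    ∀ x y : X, ‖x‖ = 1 → ‖y‖ = 1 → (∀ lam : ℝ, ‖x‖ ≤ ‖x + lam • y‖) →
      ∀ lam : ℝ, l ≤ |lam| → 1 < ‖x + lam • y‖ := by
  intro x y hx hy hxy lam hlam
  by_contra! hle
  have hu : ‖x + lam • y‖ = 1 := le_antisymm hle (hx ▸ hxy lam)
  have hlt : ‖(x + lam • y) - x‖ < l := by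
    refine h _ _ hu hx fun t ht => le_antisymm ?_ ?_
    · have hconv := convex_closedBall (0 : X) 1 (mem_closedBall_zero_iff.2 hle)
        (mem_closedBall_zero_iff.2 hx.le) ht.1 (sub_nonneg.2 ht.2) (add_sub_cancel t 1)
      exact mem_closedBall_zero_iff.1 hconv
    · have heq : t • (x + lam • y) + (1 - t) • x = x + (t * lam) • y := by module
      rw [heq, ← hx]
      exact hxy _
  rw [add_sub_cancel_left, norm_smul, hy, mul_one, Real.norm_eq_abs] at hlt
  exact hlt.not_ge hlam
end

section
/- Let X be a finite-dimensional real normed linear space of dimension at least 2 and let λ > 0. Then the *-rectangular modulus satisfies μ*_X(λ) = λ + 2, i.e., sup{(λ + t)/‖u + t·v‖ : t > 0, u, v ∈ S_X, u ⊥_B v} = λ + 2, if and only if there exist unit vectors u', v' ∈ X such that ‖t·u' + (1−t)·v'‖ = 1 for all t ∈ (0,1) and ‖u' − v'‖ = 2. -/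
/-- Reverse triangle inequality for `u + t v` with unit vectors `u` and `v`. -/
theorem sub_one_le_norm_add_smul {X : Type*} [NormedAddCommGroup X] [NormedSpace ℝ X]
    {t : ℝ} {u v : X} (ht : 0 ≤ t) (hu : ‖u‖ = 1) (hv : ‖v‖ = 1) :
    t - 1 ≤ ‖u + t • v‖ := by
  have h := norm_sub_le (u + t • v) u
  rw [add_sub_cancel_left, norm_smul, hu, hv, Real.norm_of_nonneg ht] at h
  linarith

/-- The rectangular quotient is at most `lam + 2`. -/
theorem rectangularQuotient_le {X : Type*} [NormedAddCommGroup X] [NormedSpace ℝ X]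
    {lam t : ℝ} {u v : X} (hlam : 0 < lam) (ht : 0 < t) (hu1 : ‖u‖ = 1) (hv : ‖v‖ = 1)
    (hu : 1 ≤ ‖u + t • v‖) : (lam + t) / ‖u + t • v‖ ≤ lam + 2 := by
  have h := sub_one_le_norm_add_smul ht.le hu1 hv
  rw [div_le_iff₀ (by positivity)]
  rcases le_or_gt t 2 with h2 | h2 <;> nlinarith

/-- Two unit vectors whose midpoint is a unit vector span a line outside the open unit ball. -/
theorem one_le_norm_add_smul_sub {X : Type*} [NormedAddCommGroup X] [NormedSpace ℝ X]
    {x y : X} (hx : ‖x‖ = 1) (hy : ‖y‖ = 1)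
    (hm : ‖(1 / 2 : ℝ) • x + (1 - 1 / 2 : ℝ) • y‖ = 1) (c : ℝ) :
    1 ≤ ‖y + c • (x - y)‖ := by
  obtain ⟨f, hf, hfm⟩ := exists_dual_vector'' ℝ ((1 / 2 : ℝ) • x + (1 - 1 / 2 : ℝ) • y)
  have key (z : X) : f z ≤ ‖z‖ := (le_abs_self _).trans (by
    simpa using f.le_of_opNorm_le hf z)
  have hfx := key x
  have hfy := key y
  have hc := key (y + c • (x - y))
  rw [hm] at hfm
  simp only [map_add, map_smul, map_sub, smul_eq_mul, RCLike.ofReal_real_eq_id, id_eq] at hfm hc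
  rw [hx] at hfx
  rw [hy] at hfy
  have h1 : f x = 1 := by linarith
  have h2 : f y = 1 := by linarith
  rw [h1, h2] at hc
  linarith

/-- If the supremum of the rectangular quotients is `lam + 2`, then it is attained at `t = 2`. -/
theorem exists_norm_add_two_smul_eq_one {X : Type*} [NormedAddCommGroup X] [NormedSpace ℝ X]
    [FiniteDimensional ℝ X] {lam : ℝ} (hlam : 0 < lam)
    (h : sSup { r : ℝ | ∃ t : ℝ, ∃ u v : X, 0 < t ∧ ‖u‖ = 1 ∧ ‖v‖ = 1 ∧
        (∀ c : ℝ, ‖u‖ ≤ ‖u + c • v‖) ∧ r = (lam + t) / ‖u + t • v‖ } = lam + 2) :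
    ∃ u v : X, ‖u‖ = 1 ∧ ‖v‖ = 1 ∧ (∀ c : ℝ, ‖u‖ ≤ ‖u + c • v‖) ∧ ‖u + (2 : ℝ) • v‖ = 1 := by
  let S := { r : ℝ | ∃ t : ℝ, ∃ u v : X, 0 < t ∧ ‖u‖ = 1 ∧ ‖v‖ = 1 ∧
        (∀ c : ℝ, ‖u‖ ≤ ‖u + c • v‖) ∧ r = (lam + t) / ‖u + t • v‖ }
  change sSup S = lam + 2 at h
  have hne : S.Nonempty := by
    rw [Set.nonempty_iff_ne_empty]
    intro h0
    rw [h0, Real.sSup_empty] at h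
    linarith
  have : ProperSpace X := FiniteDimensional.proper ℝ X
  let K : Set (ℝ × X × X) :=
    (Set.Icc 1 3 ×ˢ (Metric.sphere 0 1 ×ˢ Metric.sphere 0 1)) ∩
      {p | ∀ c : ℝ, ‖p.2.1‖ ≤ ‖p.2.1 + c • p.2.2‖}
  have hK : IsCompact K := by
    refine (isCompact_Icc.prod ((isCompact_sphere 0 1).prod (isCompact_sphere 0 1))).inter_right ?_
    rw [Set.ofPred_forall]
    exact isClosed_iInter fun c => isClosed_le (by fun_prop) (by fun_prop)
  have hKone (p : ℝ × X × X) (hp : p ∈ K) (c : ℝ) : 1 ≤ ‖p.2.1 + c • p.2.2‖ := by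
    obtain ⟨⟨-, hu, -⟩, ho⟩ := hp
    simpa [mem_sphere_zero_iff_norm.1 hu] using ho c
  have hcont : ContinuousOn (fun p : ℝ × X × X => (lam + p.1) / ‖p.2.1 + p.1 • p.2.2‖) K :=
    ContinuousOn.div (by fun_prop) (by fun_prop)
      fun p hp => (zero_lt_one.trans_le (hKone p hp p.1)).ne'
  have hmemK {t : ℝ} {u v : X} (ht : 0 < t) (hu : ‖u‖ = 1) (hv : ‖v‖ = 1)
      (ho : ∀ c : ℝ, ‖u‖ ≤ ‖u + c • v‖)
      (hlt : max (lam + 1) ((lam + 3) / 2) < (lam + t) / ‖u + t • v‖) : (t, u, v) ∈ K := by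
    rw [max_lt_iff] at hlt
    have h1 : 1 ≤ ‖u + t • v‖ := hu ▸ ho t
    have h2 := sub_one_le_norm_add_smul ht.le hu hv
    have h4 : (lam + t) / ‖u + t • v‖ ≤ lam + t := div_le_self (by positivity) h1
    refine ⟨⟨⟨by linarith, ?_⟩, by simpa using hu, by simpa using hv⟩, ho⟩
    by_contra! h3
    have := (lt_div_iff₀ (by positivity)).1 hlt.2
    simp only at h3
    nlinarith
  have hmax : max (lam + 1) ((lam + 3) / 2) < lam + 2 := max_lt (by linarith) (by linarith)
  have hKne : K.Nonempty := by
    obtain ⟨r, ⟨t, u, v, ht, hu, hv, ho, rfl⟩, hr⟩ := exists_lt_of_lt_csSup hne (h ▸ hmax)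
    exact ⟨_, hmemK ht hu hv ho hr⟩
  obtain ⟨⟨t, u, v⟩, hp, hpmax⟩ := hK.exists_isMaxOn hKne hcont
  have hone := hKone _ hp t
  obtain ⟨⟨⟨ht1, ht3⟩, hu, hv⟩, ho⟩ := hp
  simp only [mem_sphere_zero_iff_norm, Set.mem_ofPred_eq] at hu hv ho hone ht1 ht3
  have hge : lam + 2 ≤ (lam + t) / ‖u + t • v‖ := by
    by_contra! hlt
    obtain ⟨r, ⟨t', u', v', ht', hu', hv', ho', rfl⟩, hr⟩ :=
      exists_lt_of_lt_csSup hne (h ▸ max_lt hmax hlt)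
    rw [max_lt_iff] at hr
    exact (hpmax (hmemK ht' hu' hv' ho' hr.1)).not_gt hr.2
  have ht0 : 0 < t := by linarith
  have htri := sub_one_le_norm_add_smul ht0.le hu hv
  rw [le_div_iff₀ (by positivity)] at hge
  have ht2 : t = 2 := le_antisymm (by nlinarith) (by nlinarith)
  subst ht2
  exact ⟨u, v, hu, hv, ho, le_antisymm (by nlinarith) hone⟩

/-- The *-rectangular modulus attains its upper bound `λ + 2` iff the unit
sphere contains a straight line segment of length 2. -/
theorem stmt_4 {X : Type*} [NormedAddCommGroup X] [NormedSpace ℝ X]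
    [FiniteDimensional ℝ X] (hdim : 2 ≤ Module.finrank ℝ X)
    (lam : ℝ) (hlam : 0 < lam) :
    sSup { r : ℝ | ∃ t : ℝ, ∃ u v : X, 0 < t ∧ ‖u‖ = 1 ∧ ‖v‖ = 1 ∧
        (∀ c : ℝ, ‖u‖ ≤ ‖u + c • v‖) ∧ r = (lam + t) / ‖u + t • v‖ } = lam + 2 ↔
      ∃ u' v' : X, ‖u'‖ = 1 ∧ ‖v'‖ = 1 ∧
        (∀ t : ℝ, t ∈ Set.Ioo (0 : ℝ) 1 → ‖t • u' + (1 - t) • v'‖ = 1) ∧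
        ‖u' - v'‖ = 2 := by
  constructor
  · intro h
    obtain ⟨u, v, hu, hv, ho, h2⟩ := exists_norm_add_two_smul_eq_one hlam h
    refine ⟨u + (2 : ℝ) • v, u, h2, hu, fun t ht => le_antisymm ?_ ?_, ?_⟩
    · calc ‖t • (u + (2 : ℝ) • v) + (1 - t) • u‖
          ≤ ‖t • (u + (2 : ℝ) • v)‖ + ‖(1 - t) • u‖ := norm_add_le _ _
        _ = 1 := by
          rw [norm_smul, norm_smul, h2, hu, Real.norm_of_nonneg ht.1.le,
            Real.norm_of_nonneg (by linarith [ht.2])]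
          ring
    · have heq : t • (u + (2 : ℝ) • v) + (1 - t) • u = u + (t * 2) • v := by module
      rw [heq, ← hu]
      exact ho _
    · rw [add_sub_cancel_left, norm_smul, hv]
      norm_num
  · rintro ⟨x, y, hx, hy, hseg, hxy⟩
    have hline := one_le_norm_add_smul_sub hx hy (hseg (1 / 2) (by norm_num))
    refine IsGreatest.csSup_eq
      ⟨⟨2, y, (1 / 2 : ℝ) • (x - y), two_pos, hy, ?_, fun c => ?_, ?_⟩, ?_⟩
    · rw [norm_smul, hxy]
      norm_num
    · rw [hy, smul_smul]
      exact hline _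
    · rw [smul_smul]
      norm_num [hx]
    · rintro r ⟨t, u, v, ht, hu, hv, ho, rfl⟩
      exact rectangularQuotient_le hlam ht hu hv (hu ▸ ho t)
end

section
/- Let X be a real normed linear space and λ > 0. If there exist unit vectors u, v ∈ X such that ‖t·u + (1−t)·v‖ = 1 for all t ∈ (0,1) and ‖u − v‖ = 2, then the value λ + 2 is attained by the *-rectangular modulus: there exist unit vectors u₀, v₀ ∈ X with u₀ ⊥_B v₀ and a real t₀ > 0 such that (λ + t₀)/‖u₀ + t₀·v₀‖ = λ + 2. -/
theorem stmt_5 {X : Type*} [NormedAddCommGroup X] [NormedSpace ℝ X]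
    (lam : ℝ) (hlam : 0 < lam)
    (u v : X) (hu : ‖u‖ = 1) (hv : ‖v‖ = 1)
    (hseg : ∀ t : ℝ, t ∈ Set.Ioo (0 : ℝ) 1 → ‖t • u + (1 - t) • v‖ = 1)
    (hdist : ‖u - v‖ = 2) :
    ∃ u₀ v₀ : X, ∃ t₀ : ℝ, ‖u₀‖ = 1 ∧ ‖v₀‖ = 1 ∧
      (∀ c : ℝ, ‖u₀‖ ≤ ‖u₀ + c • v₀‖) ∧ 0 < t₀ ∧
      (lam + t₀) / ‖u₀ + t₀ • v₀‖ = lam + 2 := by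
  have hline (s : ℝ) : 1 ≤ ‖s • u + (1 - s) • v‖ := by
    have hsu : ‖s • u‖ = |s| := by rw [norm_smul, hu, mul_one, Real.norm_eq_abs]
    have hsv : ‖(1 - s) • v‖ = |1 - s| := by rw [norm_smul, hv, mul_one, Real.norm_eq_abs]
    rcases le_or_gt s 0 with h0 | h0
    · have h := norm_sub_le_norm_add ((1 - s) • v) (s • u)
      rw [hsu, hsv, abs_of_nonpos h0, abs_of_nonneg (by linarith), add_comm (_ • v)] at h
      linarith
    rcases lt_or_ge s 1 with h1 | h1
    · exact (hseg s ⟨h0, h1⟩).ge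
    · have h := norm_sub_le_norm_add (s • u) ((1 - s) • v)
      rw [hsu, hsv, abs_of_pos h0, abs_of_nonpos (by linarith)] at h
      linarith
  refine ⟨u, (1 / 2 : ℝ) • (v - u), 2, hu, ?_, fun c => ?_, two_pos, ?_⟩
  · rw [norm_smul, norm_sub_rev, hdist]
    norm_num
  · rw [hu, show u + c • (1 / 2 : ℝ) • (v - u) = (1 - c / 2) • u + (1 - (1 - c / 2)) • v by module]
    exact hline _
  · rw [show u + (2 : ℝ) • (1 / 2 : ℝ) • (v - u) = v by module, hv, div_one]
end

section
/- Let X be a finite-dimensional real normed linear space of dimension at least 2. Then the rectangular constant μ(X) = sup{(‖x‖ + ‖y‖)/‖x + y‖ : x, y ∈ X \ {0}, x ⊥_B y} equals 3 if and only if there exist unit vectors u, v ∈ X such that ‖t·u + (1−t)·v‖ = 1 for all t ∈ (0,1) and ‖u − v‖ = 2. -/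
section BirkhoffJames

variable {X : Type*} [NormedAddCommGroup X] [NormedSpace ℝ X]

theorem norm_add_norm_le_three_mul_of_birkhoff {x y : X}
    (h : ∀ lam : ℝ, ‖x‖ ≤ ‖x + lam • y‖) : ‖x‖ + ‖y‖ ≤ 3 * ‖x + y‖ := by
  have h₁ : ‖x‖ ≤ ‖x + y‖ := by simpa using h 1
  have h₂ : ‖y‖ ≤ ‖x + y‖ + ‖x‖ := by simpa using norm_sub_le (x + y) x
  linarith

theorem norm_add_pos_of_birkhoff {x y : X} (hx : x ≠ 0)
    (h : ∀ lam : ℝ, ‖x‖ ≤ ‖x + lam • y‖) : 0 < ‖x + y‖ :=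
  (norm_pos_iff.2 hx).trans_le (by simpa using h 1)

theorem rectangular_ratio_le_three {x y : X} (hx : x ≠ 0)
    (h : ∀ lam : ℝ, ‖x‖ ≤ ‖x + lam • y‖) : (‖x‖ + ‖y‖) / ‖x + y‖ ≤ 3 :=
  (div_le_iff₀ (norm_add_pos_of_birkhoff hx h)).2 (norm_add_norm_le_three_mul_of_birkhoff h)

/-- Rescaling so that the first vector is a unit vector. -/
theorem exists_unit_birkhoff_of_two_le_ratio {x y : X} (hx : x ≠ 0)
    (h : ∀ lam : ℝ, ‖x‖ ≤ ‖x + lam • y‖) (hr : 2 ≤ (‖x‖ + ‖y‖) / ‖x + y‖) :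
    ∃ a b : X, ‖a‖ = 1 ∧ ‖b‖ ≤ 3 ∧ (∀ lam : ℝ, 1 ≤ ‖a + lam • b‖) ∧
      (‖x‖ + ‖y‖) / ‖x + y‖ = (1 + ‖b‖) / ‖a + b‖ := by
  have hx' : 0 < ‖x‖ := norm_pos_iff.2 hx
  have hnorm : ∀ z : X, ‖‖x‖⁻¹ • z‖ = ‖z‖ / ‖x‖ := fun z => by
    rw [norm_smul, norm_inv, norm_norm, div_eq_inv_mul]
  refine ⟨‖x‖⁻¹ • x, ‖x‖⁻¹ • y, ?_, ?_, fun lam => ?_, ?_⟩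
  · rw [hnorm, div_self hx'.ne']
  · have h₂ : ‖y‖ ≤ ‖x + y‖ + ‖x‖ := by simpa using norm_sub_le (x + y) x
    rw [le_div_iff₀ (norm_add_pos_of_birkhoff hx h)] at hr
    rw [hnorm, div_le_iff₀ hx']
    linarith
  · rw [smul_comm, ← smul_add, hnorm, le_div_iff₀ hx', one_mul]
    exact h lam
  · have hxy := norm_add_pos_of_birkhoff hx h
    rw [← smul_add, hnorm, hnorm]
    field_simp

theorem exists_isMaxOn_rectangular_ratio [FiniteDimensional ℝ X] {a₀ b₀ : X}
    (ha₀ : ‖a₀‖ = 1) (hb₀ : ‖b₀‖ ≤ 3) (h₀ : ∀ lam : ℝ, 1 ≤ ‖a₀ + lam • b₀‖) :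
    ∃ a b : X, ‖a‖ = 1 ∧ (∀ lam : ℝ, 1 ≤ ‖a + lam • b‖) ∧
      ∀ a' b' : X, ‖a'‖ = 1 → ‖b'‖ ≤ 3 → (∀ lam : ℝ, 1 ≤ ‖a' + lam • b'‖) →
        (1 + ‖b'‖) / ‖a' + b'‖ ≤ (1 + ‖b‖) / ‖a + b‖ := by
  have : ProperSpace X := FiniteDimensional.proper ℝ X
  let K : Set (X × X) := (Metric.sphere 0 1 ×ˢ Metric.closedBall 0 3) ∩
    {p | ∀ lam : ℝ, 1 ≤ ‖p.1 + lam • p.2‖}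
  have hK : IsCompact K := by
    refine ((isCompact_sphere _ _).prod (isCompact_closedBall _ _)).inter_right ?_
    simp only [Set.ofPred_forall]
    exact isClosed_iInter fun lam => isClosed_le continuous_const (by fun_prop)
  have hf : ContinuousOn (fun p : X × X => (1 + ‖p.2‖) / ‖p.1 + p.2‖) K := by
    refine ContinuousOn.div (by fun_prop) (by fun_prop) fun p hp => ?_
    have := hp.2 1
    rw [one_smul] at this
    linarith
  obtain ⟨p, hp, hmax⟩ := hK.exists_isMaxOn
    ⟨(a₀, b₀), by simpa [K] using ⟨⟨ha₀, hb₀⟩, h₀⟩⟩ hf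
  refine ⟨p.1, p.2, by simpa using hp.1.1, hp.2, fun a' b' ha hb h => ?_⟩
  exact hmax (show (a', b') ∈ K by simpa [K] using ⟨⟨ha, hb⟩, h⟩)

/-- If the line segment joining two unit vectors lies in the unit sphere, the whole line avoids the
open unit ball. -/
theorem one_le_norm_add_smul_sub_s7 {u v : X} (hu : ‖u‖ = 1) (hv : ‖v‖ = 1)
    (h : ∀ t : ℝ, t ∈ Set.Ioo (0 : ℝ) 1 → ‖t • u + (1 - t) • v‖ = 1) (lam : ℝ) :
    1 ≤ ‖v + lam • (u - v)‖ := by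
  rcases le_or_gt lam 0 with h₀ | h₀
  · have key : (1 - lam) • v = (v + lam • (u - v)) + (-lam) • u := by module
    have := norm_add_le (v + lam • (u - v)) ((-lam) • u)
    rw [← key, norm_smul, norm_smul, hu, hv, Real.norm_of_nonneg (by linarith),
      Real.norm_of_nonneg (by linarith)] at this
    linarith
  rcases lt_or_ge lam 1 with h₁ | h₁
  · rw [← h lam ⟨h₀, h₁⟩]
    exact le_of_eq (congrArg _ (by module))
  · have key : lam • u = (v + lam • (u - v)) + (lam - 1) • v := by module
    have := norm_add_le (v + lam • (u - v)) ((lam - 1) • v)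
    rw [← key, norm_smul, norm_smul, hu, hv, Real.norm_of_nonneg (by linarith),
      Real.norm_of_nonneg (by linarith)] at this
    linarith

end BirkhoffJames

/-- The rectangular constant equals 3 iff the unit sphere contains a straight
line segment of length 2. -/
theorem stmt_7 {X : Type*} [NormedAddCommGroup X] [NormedSpace ℝ X]
    [FiniteDimensional ℝ X] (hdim : 2 ≤ Module.finrank ℝ X) :
    sSup { r : ℝ | ∃ x y : X, x ≠ 0 ∧ y ≠ 0 ∧
        (∀ lam : ℝ, ‖x‖ ≤ ‖x + lam • y‖) ∧ r = (‖x‖ + ‖y‖) / ‖x + y‖ } = 3 ↔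
      ∃ u v : X, ‖u‖ = 1 ∧ ‖v‖ = 1 ∧
        (∀ t : ℝ, t ∈ Set.Ioo (0 : ℝ) 1 → ‖t • u + (1 - t) • v‖ = 1) ∧
        ‖u - v‖ = 2 := by
  constructor
  · intro hS
    have hne : Set.Nonempty { r : ℝ | ∃ x y : X, x ≠ 0 ∧ y ≠ 0 ∧
        (∀ lam : ℝ, ‖x‖ ≤ ‖x + lam • y‖) ∧ r = (‖x‖ + ‖y‖) / ‖x + y‖ } := by
      by_contra h
      rw [Set.not_nonempty_iff_eq_empty.1 h, Real.sSup_empty] at hS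
      norm_num at hS
    have happrox : ∀ c : ℝ, 2 ≤ c → c < 3 → ∃ a b : X, ‖a‖ = 1 ∧ ‖b‖ ≤ 3 ∧
        (∀ lam : ℝ, 1 ≤ ‖a + lam • b‖) ∧ c < (1 + ‖b‖) / ‖a + b‖ := by
      intro c hc hc3
      obtain ⟨r, ⟨x, y, hx, -, h, rfl⟩, hr⟩ := exists_lt_of_lt_csSup hne (hc3.trans_eq hS.symm)
      obtain ⟨a, b, ha, hb, hab, heq⟩ :=
        exists_unit_birkhoff_of_two_le_ratio hx h (hc.trans hr.le)
      exact ⟨a, b, ha, hb, hab, heq ▸ hr⟩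
    obtain ⟨a₀, b₀, ha₀, hb₀, h₀, -⟩ := happrox 2 le_rfl (by norm_num)
    obtain ⟨a, b, ha, hab, hmax⟩ := exists_isMaxOn_rectangular_ratio ha₀ hb₀ h₀
    have h3 : 3 ≤ (1 + ‖b‖) / ‖a + b‖ := by
      by_contra! hlt
      obtain ⟨a', b', ha', hb', h', hgt⟩ := happrox _ (le_max_left 2 _)
        (max_lt (by norm_num) hlt)
      exact absurd (hmax a' b' ha' hb' h') (not_le.2 ((le_max_right _ _).trans_lt hgt))
    have h1 : 1 ≤ ‖a + b‖ := by simpa using hab 1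
    rw [le_div_iff₀ (by linarith)] at h3
    have htri : ‖b‖ ≤ ‖a + b‖ + ‖a‖ := by simpa using norm_sub_le (a + b) a
    have hsum : ‖a + b‖ = 1 := by linarith
    refine ⟨a + b, a, hsum, ha, fun t ht => le_antisymm ?_ ?_, ?_⟩
    · refine (norm_add_le _ _).trans_eq ?_
      rw [norm_smul, norm_smul, hsum, ha, Real.norm_of_nonneg ht.1.le,
        Real.norm_of_nonneg (sub_nonneg.2 ht.2.le)]
      ring
    · exact (hab t).trans_eq (congrArg _ (by module))
    · rw [add_sub_cancel_left]
      linarith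
  · rintro ⟨u, v, hu, hv, h, huv⟩
    refine IsGreatest.csSup_eq ⟨⟨v, u - v, ?_, ?_, fun lam => ?_, ?_⟩, ?_⟩
    · exact norm_pos_iff.1 (by rw [hv]; norm_num)
    · exact norm_pos_iff.1 (by rw [huv]; norm_num)
    · rw [hv]
      exact one_le_norm_add_smul_sub_s7 hu hv h lam
    · rw [add_sub_cancel, hu, hv, huv]
      norm_num
    · rintro r ⟨x, y, hx, -, hxy, rfl⟩
      exact rectangular_ratio_le_three hx hxy
end

section
/- Let X be a two-dimensional real normed linear space whose closed unit ball has only finitely many extreme points (a polyhedral space). Then for any nonzero x, y ∈ X with x ⊥_B y, there exist u, v ∈ X with v nonzero, u an extreme point of the closed unit ball of X (so ‖u‖ = 1), and u ⊥_B v, such that (‖x‖ + ‖y‖)/‖x + y‖ ≤ (‖u‖ + ‖v‖)/‖u + v‖. -/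
/-- Two Birkhoff-James orthogonal nonzero vectors of a plane span it. -/
theorem exists_smul_add_smul_eq_of_birkhoff {X : Type*} [NormedAddCommGroup X] [NormedSpace ℝ X]
    (hdim : Module.finrank ℝ X = 2) {x y : X} (hx : x ≠ 0) (hy : y ≠ 0)
    (hxy : ∀ lam : ℝ, ‖x‖ ≤ ‖x + lam • y‖) (z : X) :
    ∃ s t : ℝ, s • x + t • y = z := by
  have hli : LinearIndependent ℝ ![x, y] := by
    rw [LinearIndependent.pair_iff' hx]
    intro a ha
    have ha0 : a ≠ 0 := by
      rintro rfl
      exact hy (by simpa using ha.symm)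
    have h := hxy (-a⁻¹)
    rw [← ha, smul_smul, neg_mul, inv_mul_cancel₀ ha0] at h
    simp at h
    exact hx h
  have : FiniteDimensional ℝ X := .of_finrank_pos (by simp [hdim])
  have hspan := hli.span_eq_top_of_card_eq_finrank' (by simp [hdim])
  have hz : z ∈ Submodule.span ℝ (Set.range ![x, y]) := hspan ▸ Submodule.mem_top
  rw [Matrix.range_cons_cons_empty] at hz
  exact Submodule.mem_span_pair.1 hz

/-- If `x ⊥_B y`, then `|s| ‖x‖ ≤ ‖s x + t y‖`. -/
theorem abs_mul_norm_le_of_birkhoff {X : Type*} [NormedAddCommGroup X] [NormedSpace ℝ X]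
    {x y : X} (hxy : ∀ lam : ℝ, ‖x‖ ≤ ‖x + lam • y‖) (s t : ℝ) :
    |s| * ‖x‖ ≤ ‖s • x + t • y‖ := by
  rcases eq_or_ne s 0 with rfl | hs
  · simp
  · calc |s| * ‖x‖ ≤ |s| * ‖x + (s⁻¹ * t) • y‖ :=
          mul_le_mul_of_nonneg_left (hxy _) (abs_nonneg s)
      _ = ‖s • x + t • y‖ := by
          rw [← Real.norm_eq_abs, ← norm_smul, smul_add, smul_smul, mul_inv_cancel_left₀ hs]

/-- If a unit vector `x` of a plane is Birkhoff-James orthogonal to `y ≠ 0`, then going backwards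
from `x` along `y` as far as the unit ball allows leads to an extreme point. -/
theorem exists_extremePoint_add_smul_of_birkhoff {X : Type*} [NormedAddCommGroup X]
    [NormedSpace ℝ X] (hdim : Module.finrank ℝ X = 2) {x y : X} (hx : ‖x‖ = 1) (hy : y ≠ 0)
    (hxy : ∀ lam : ℝ, ‖x‖ ≤ ‖x + lam • y‖) :
    ∃ α : ℝ, α ≤ 0 ∧ ‖x + α • y‖ = 1 ∧
      x + α • y ∈ Set.extremePoints ℝ (Metric.closedBall (0 : X) 1) := by
  have hx0 : x ≠ 0 := norm_ne_zero_iff.1 (by rw [hx]; exact one_ne_zero)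
  have hy0 : 0 < ‖y‖ := norm_pos_iff.2 hy
  have hcpt : IsCompact {t : ℝ | ‖x + t • y‖ ≤ 1} := by
    refine Metric.isCompact_of_isClosed_isBounded
      (isClosed_le (by fun_prop) continuous_const) ?_
    refine (Metric.isBounded_closedBall (x := (0 : ℝ)) (r := 2 / ‖y‖)).subset fun t ht => ?_
    rw [mem_closedBall_zero_iff, le_div_iff₀ hy0, ← norm_smul]
    have h := norm_sub_le (x + t • y) x
    rw [add_sub_cancel_left] at h
    have ht' : ‖x + t • y‖ ≤ 1 := ht
    linarith
  obtain ⟨α, hα, hmin⟩ := hcpt.exists_isLeast ⟨0, by simp [hx]⟩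
  have hα1 : ‖x + α • y‖ ≤ 1 := hα
  refine ⟨α, hmin (by simp [hx]), le_antisymm hα1 (hx ▸ hxy α), ?_⟩
  have hcoef : ∀ s t : ℝ, ‖s • x + t • y‖ ≤ 1 → s ≤ 1 := fun s t h => by
    have := abs_mul_norm_le_of_birkhoff hxy s t
    rw [hx, mul_one] at this
    exact (le_abs_self s).trans (this.trans h)
  have huniq : ∀ s t : ℝ, s • x + t • y = 0 → s = 0 ∧ t = 0 := fun s t h => by
    have hs := abs_mul_norm_le_of_birkhoff hxy s t
    rw [h, hx, mul_one, norm_zero] at hs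
    have hs0 : s = 0 := abs_nonpos_iff.1 hs
    subst hs0
    simpa [hy] using h
  rw [mem_extremePoints_iff_left]
  refine ⟨by simpa using hα1, fun c hc d hd hcd => ?_⟩
  obtain ⟨s, t, rfl⟩ := exists_smul_add_smul_eq_of_birkhoff hdim hx0 hy hxy c
  obtain ⟨s', t', rfl⟩ := exists_smul_add_smul_eq_of_birkhoff hdim hx0 hy hxy d
  rw [mem_closedBall_zero_iff] at hc hd
  obtain ⟨a, b, ha, hb, hab, h⟩ := hcd
  obtain ⟨h1, h2⟩ := huniq (a * s + b * s' - 1) (a * t + b * t' - α) (by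
    rw [← sub_eq_zero] at h
    rw [← h]
    module)
  have hs := hcoef s t hc
  have hs' := hcoef s' t' hd
  obtain rfl : s = 1 := by nlinarith
  obtain rfl : s' = 1 := by nlinarith
  rw [one_smul] at hc hd
  have ht : α ≤ t := hmin hc
  have ht' : α ≤ t' := hmin hd
  obtain rfl : t = α := by
    refine le_antisymm (not_lt.1 fun hlt => ?_) ht
    have h3 := mul_pos ha (sub_pos.2 hlt)
    have h4 := mul_nonneg hb.le (sub_nonneg.2 ht')
    have h5 : (a + b) * α = α := by rw [hab, one_mul]
    linarith
  rw [one_smul]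

theorem stmt_8 {X : Type*} [NormedAddCommGroup X] [NormedSpace ℝ X]
    [FiniteDimensional ℝ X] (hdim : Module.finrank ℝ X = 2)
    (hpoly : (Set.extremePoints ℝ (Metric.closedBall (0 : X) 1)).Finite)
    (x y : X) (hx : x ≠ 0) (hy : y ≠ 0)
    (hxy : ∀ lam : ℝ, ‖x‖ ≤ ‖x + lam • y‖) :
    ∃ u v : X, v ≠ 0 ∧ u ∈ Set.extremePoints ℝ (Metric.closedBall (0 : X) 1) ∧
      ‖u‖ = 1 ∧ (∀ lam : ℝ, ‖u‖ ≤ ‖u + lam • v‖) ∧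
      (‖x‖ + ‖y‖) / ‖x + y‖ ≤ (‖u‖ + ‖v‖) / ‖u + v‖ := by
  have hr : 0 < ‖x‖ := norm_pos_iff.2 hx
  set e : X := ‖x‖⁻¹ • x with he
  have he1 : ‖e‖ = 1 := norm_smul_inv_norm hx
  have hey : ∀ lam : ℝ, ‖e‖ ≤ ‖e + lam • y‖ := fun lam => by
    have h := abs_mul_norm_le_of_birkhoff hxy ‖x‖⁻¹ lam
    rwa [abs_of_pos (inv_pos.2 hr), inv_mul_cancel₀ hr.ne', ← he1] at h
  obtain ⟨α, hα, hnorm, hext⟩ := exists_extremePoint_add_smul_of_birkhoff hdim he1 hy hey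
  have hpos : 0 < ‖x‖⁻¹ - α := by linarith [inv_pos.2 hr]
  refine ⟨e + α • y, (‖x‖⁻¹ - α) • y, smul_ne_zero hpos.ne' hy, hext, hnorm, fun lam => ?_, ?_⟩
  · rw [hnorm, smul_smul, add_assoc, ← add_smul, ← he1]
    exact hey _
  · have hsum : e + α • y + (‖x‖⁻¹ - α) • y = ‖x‖⁻¹ • (x + y) := by
      rw [he]
      module
    rw [hsum, hnorm, norm_smul, norm_smul, norm_inv, norm_norm, Real.norm_of_nonneg hpos.le]
    calc (‖x‖ + ‖y‖) / ‖x + y‖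
        = (‖x‖⁻¹ * (‖x‖ + ‖y‖)) / (‖x‖⁻¹ * ‖x + y‖) :=
          (mul_div_mul_left _ _ (inv_pos.2 hr).ne').symm
      _ ≤ (1 + (‖x‖⁻¹ - α) * ‖y‖) / (‖x‖⁻¹ * ‖x + y‖) := by
          refine div_le_div_of_nonneg_right ?_ (by positivity)
          rw [mul_add, inv_mul_cancel₀ hr.ne']
          nlinarith [norm_nonneg y]
end

section
/- Let X be a real normed linear space, let x₁, x₂ ∈ X be unit vectors, let t ∈ (0,1), and set x = t·x₁ + (1−t)·x₂. If ‖x‖ = 1 and x ⊥_B y for some y ∈ X, then x₁ ⊥_B y and x₂ ⊥_B y. -/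
theorem stmt_9 {X : Type*} [NormedAddCommGroup X] [NormedSpace ℝ X]
    (x₁ x₂ : X) (hx₁ : ‖x₁‖ = 1) (hx₂ : ‖x₂‖ = 1)
    (t : ℝ) (ht : t ∈ Set.Ioo (0 : ℝ) 1)
    (hx : ‖t • x₁ + (1 - t) • x₂‖ = 1) (y : X)
    (hxy : ∀ lam : ℝ, ‖t • x₁ + (1 - t) • x₂‖ ≤ ‖t • x₁ + (1 - t) • x₂ + lam • y‖) :
    (∀ lam : ℝ, ‖x₁‖ ≤ ‖x₁ + lam • y‖) ∧ (∀ lam : ℝ, ‖x₂‖ ≤ ‖x₂ + lam • y‖) := by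
  obtain ⟨ht₀, ht₁⟩ := ht
  have ht₂ : 0 < 1 - t := sub_pos.2 ht₁
  have norm_combo (u v : X) : ‖t • u + (1 - t) • v‖ ≤ t * ‖u‖ + (1 - t) * ‖v‖ := by
    simpa only [norm_smul, Real.norm_of_nonneg ht₀.le, Real.norm_of_nonneg ht₂.le]
      using norm_add_le (t • u) ((1 - t) • v)
  refine ⟨fun lam => ?_, fun lam => ?_⟩
  · have h := hxy (t * lam)
    rw [hx, show t • x₁ + (1 - t) • x₂ + (t * lam) • y
      = t • (x₁ + lam • y) + (1 - t) • x₂ by module] at h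
    have h' := h.trans (norm_combo _ _)
    rw [hx₂] at h'
    rw [hx₁]
    exact le_of_mul_le_mul_left (by linarith) ht₀
  · have h := hxy ((1 - t) * lam)
    rw [hx, show t • x₁ + (1 - t) • x₂ + ((1 - t) * lam) • y
      = t • x₁ + (1 - t) • (x₂ + lam • y) by module] at h
    have h' := h.trans (norm_combo _ _)
    rw [hx₁] at h'
    rw [hx₂]
    exact le_of_mul_le_mul_left (by linarith) ht₂
end

section
/- Let X be a finite-dimensional real normed linear space of dimension at least 2. Then X is an inner product space (equivalently, its norm satisfies the parallelogram law: ‖x + y‖² + ‖x − y‖² = 2‖x‖² + 2‖y‖² for all x, y ∈ X) if and only if for all unit vectors x, y ∈ X with x ⊥_B y and all real λ with 3 − 2√2 < |λ| < √2 + 1, one has (1 + |λ|)/‖y + λ·x‖ ≤ √2. -/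
section

open Real Set Filter Topology MeasureTheory

/-- The standard area form on the plane. -/
def areaForm (z w : ℂ) : ℝ := z.re * w.im - z.im * w.re

theorem LocallyLipschitz.absolutelyContinuousOnInterval {f : ℝ → ℝ} (hf : LocallyLipschitz f)
    (a b : ℝ) : AbsolutelyContinuousOnInterval f a b := by
  obtain ⟨K, hK⟩ := (hf.locallyLipschitzOn (s := uIcc a b)).exists_lipschitzOnWith_of_compact
    isCompact_uIcc
  exact hK.absolutelyContinuousOnInterval

theorem LocallyLipschitz.eq_of_ae_hasDerivAt_zero {f : ℝ → ℝ} (hf : LocallyLipschitz f)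
    (h : ∀ᵐ t, HasDerivAt f 0 t) (a b : ℝ) : f a = f b := by
  obtain ⟨C, hC⟩ := (hf.absolutelyContinuousOnInterval a b).const_of_ae_hasDerivAt_zero
    (h.mono fun t ht _ => ht)
  rw [hC a left_mem_uIcc, hC b right_mem_uIcc]

theorem LocallyLipschitz.monotone_of_ae_hasDerivAt_nonneg {f : ℝ → ℝ} (hf : LocallyLipschitz f)
    (h : ∀ᵐ t, ∃ d, 0 ≤ d ∧ HasDerivAt f d t) : Monotone f := by
  intro a b hab
  have := (hf.absolutelyContinuousOnInterval a b).integral_deriv_eq_sub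
  have h2 : 0 ≤ ∫ x in a..b, deriv f x := by
    apply intervalIntegral.integral_nonneg_of_ae hab
    filter_upwards [h] with t ⟨d, hd, hd'⟩
    simpa [hd'.deriv] using hd
  linarith

theorem LocallyLipschitz.comp_contDiffAt {E : Type*} [NormedAddCommGroup E] [NormedSpace ℝ E]
    {F : Type*} [NormedAddCommGroup F] [NormedSpace ℝ F]
    {g : ℝ → E} {f : E → F} (hg : LocallyLipschitz g) (hf : ∀ t, ContDiffAt ℝ 1 f (g t)) :
    LocallyLipschitz fun t => f (g t) := by
  intro t
  obtain ⟨K, u, hu, hK⟩ := (hf t).exists_lipschitzOnWith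
  obtain ⟨L, v, hv, hL⟩ := hg t
  refine ⟨K * L, v ∩ g ⁻¹' u, inter_mem hv (hg.continuous.continuousAt hu), ?_⟩
  exact hK.comp (hL.mono inter_subset_left) fun s hs => hs.2

theorem LocallyLipschitz.ae_differentiableAt {f : ℝ → ℝ} (hf : LocallyLipschitz f) :
    ∀ᵐ t, DifferentiableAt ℝ f t := by
  have : ∀ n : ℕ, ∀ᵐ t, t ∈ uIcc (-n : ℝ) n → DifferentiableAt ℝ f t := fun n =>
    (hf.absolutelyContinuousOnInterval _ _).ae_differentiableAt
  filter_upwards [ae_all_iff.2 this] with t ht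
  obtain ⟨n, hn⟩ := exists_nat_ge |t|
  refine ht n ?_
  rw [uIcc_of_le (by linarith [abs_nonneg t])]
  exact abs_le.1 hn

theorem HasDerivAt.areaForm {x y : ℝ → ℂ} {x' y' : ℂ} {t : ℝ} (hx : HasDerivAt x x' t)
    (hy : HasDerivAt y y' t) :
    HasDerivAt (fun s => areaForm (x s) (y s)) (areaForm x' (y t) + areaForm (x t) y') t := by
  have re {z : ℝ → ℂ} {z' : ℂ} (h : HasDerivAt z z' t) : HasDerivAt (fun s => (z s).re) z'.re t :=
    Complex.reCLM.hasFDerivAt.comp_hasDerivAt t h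
  have im {z : ℝ → ℂ} {z' : ℂ} (h : HasDerivAt z z' t) : HasDerivAt (fun s => (z s).im) z'.im t :=
    Complex.imCLM.hasFDerivAt.comp_hasDerivAt t h
  refine (((re hx).mul (im hy)).sub ((im hx).mul (re hy))).congr_deriv ?_
  simp only [_root_.areaForm]; ring

variable {N : Seminorm ℝ ℂ}

theorem Seminorm.map_ofReal_mul (N : Seminorm ℝ ℂ) (a : ℝ) (z : ℂ) : N (a * z) = |a| * N z := by
  rw [← Complex.real_smul, map_smul_eq_mul, Real.norm_eq_abs]

theorem Seminorm.exists_le_mul_norm (N : Seminorm ℝ ℂ) : ∃ K, 0 ≤ K ∧ ∀ z, N z ≤ K * ‖z‖ := by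
  refine ⟨N 1 + N Complex.I, by positivity, fun z => ?_⟩
  calc N z = N (z.re * 1 + z.im * Complex.I) := by rw [mul_one, Complex.re_add_im]
    _ ≤ |z.re| * N 1 + |z.im| * N Complex.I := by
      refine (map_add_le_add N _ _).trans_eq ?_
      rw [N.map_ofReal_mul, N.map_ofReal_mul]
    _ ≤ ‖z‖ * N 1 + ‖z‖ * N Complex.I := by
      gcongr
      exacts [Complex.abs_re_le_norm z, Complex.abs_im_le_norm z]
    _ = _ := by ring

theorem Seminorm.exists_lipschitzWith (N : Seminorm ℝ ℂ) : ∃ K, LipschitzWith K N := by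
  obtain ⟨K, hK, h⟩ := N.exists_le_mul_norm
  refine ⟨⟨K, hK⟩, LipschitzWith.of_dist_le_mul fun z w => ?_⟩
  rw [Real.dist_eq, dist_eq_norm]
  exact (abs_sub_map_le_sub N z w).trans (h _)

/-- The radial function of the unit ball of `N`. -/
noncomputable def radial (N : Seminorm ℝ ℂ) (θ : ℝ) : ℝ := (N (Complex.exp (θ * Complex.I)))⁻¹

/-- The point of the unit sphere of `N` in direction `θ`. -/
noncomputable def polarPoint (N : Seminorm ℝ ℂ) (θ : ℝ) : ℂ :=
  radial N θ * Complex.exp (θ * Complex.I)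

theorem exp_add_pi_mul_I (θ : ℝ) :
    Complex.exp (((θ + π : ℝ) : ℂ) * Complex.I) = -Complex.exp (θ * Complex.I) := by
  push_cast
  rw [add_mul, Complex.exp_add, Complex.exp_pi_mul_I, mul_neg_one]

theorem radial_add_pi (θ : ℝ) : radial N (θ + π) = radial N θ := by
  rw [radial, exp_add_pi_mul_I, map_neg_eq_map, radial]

theorem polarPoint_add_pi (θ : ℝ) : polarPoint N (θ + π) = -polarPoint N θ := by
  rw [polarPoint, exp_add_pi_mul_I, radial_add_pi, polarPoint, mul_neg]

theorem norm_polar_pos (hN : ∀ z, N z = 0 → z = 0) (θ : ℝ) :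
    0 < N (Complex.exp (θ * Complex.I)) :=
  (apply_nonneg N _).lt_of_ne fun h => Complex.exp_ne_zero _ (hN _ h.symm)

theorem radial_pos (hN : ∀ z, N z = 0 → z = 0) (θ : ℝ) : 0 < radial N θ :=
  inv_pos.2 (norm_polar_pos hN θ)

theorem apply_polarPoint (hN : ∀ z, N z = 0 → z = 0) (θ : ℝ) : N (polarPoint N θ) = 1 := by
  rw [polarPoint, N.map_ofReal_mul, abs_of_pos (radial_pos hN θ), radial,
    inv_mul_cancel₀ (norm_polar_pos hN θ).ne']

theorem locallyLipschitz_radial (hN : ∀ z, N z = 0 → z = 0) : LocallyLipschitz (radial N) := by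
  obtain ⟨K, hK⟩ := N.exists_lipschitzWith
  have h1 : ContDiff ℝ 1 fun θ : ℝ => Complex.exp (θ * Complex.I) := by
    have : ContDiff ℝ 1 fun θ : ℝ => (θ : ℂ) := Complex.ofRealCLM.contDiff
    fun_prop
  have h2 := hK.locallyLipschitz.comp h1.locallyLipschitz
  refine h2.comp_contDiffAt (f := fun x : ℝ => x⁻¹) fun t =>
    contDiffAt_inv _ (norm_polar_pos hN t).ne'

theorem areaForm_polarPoint (s t : ℝ) :
    areaForm (polarPoint N s) (polarPoint N t) = radial N s * radial N t * sin (t - s) := by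
  simp only [areaForm, polarPoint, Complex.re_ofReal_mul, Complex.im_ofReal_mul,
    Complex.exp_ofReal_mul_I_re, Complex.exp_ofReal_mul_I_im, sin_sub]
  ring

theorem polar_eq_of_eq_mul (hN : ∀ z, N z = 0 → z = 0) {z : ℂ} {c θ : ℝ} (hc : 0 < c)
    (h : z = c * Complex.exp (θ * Complex.I)) : z = N z * polarPoint N θ := by
  rw [polarPoint, ← mul_assoc, ← Complex.ofReal_mul, h, N.map_ofReal_mul, radial, mul_assoc,
    mul_inv_cancel₀ (norm_polar_pos hN θ).ne', mul_one, abs_of_pos hc]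

theorem eq_apply_mul_polarPoint_arg (hN : ∀ z, N z = 0 → z = 0) (z : ℂ) :
    z = N z * polarPoint N z.arg := by
  rcases eq_or_ne z 0 with rfl | hz
  · simp
  · exact polar_eq_of_eq_mul hN (norm_pos_iff.2 hz) (Complex.norm_mul_exp_arg_mul_I z).symm

/-- The direction `b` is conjugate to the direction `a`: the unit sphere of `N` has at
`polarPoint N a` a supporting line parallel to `polarPoint N b`, with positive orientation. -/
def ConjDir (N : Seminorm ℝ ℂ) (a b : ℝ) : Prop :=
  a < b ∧ b < a + π ∧
    ∀ s, areaForm (polarPoint N s) (polarPoint N b) ≤ areaForm (polarPoint N a) (polarPoint N b)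

theorem areaForm_mul_left (c : ℝ) (z w : ℂ) : areaForm (c * z) w = c * areaForm z w := by
  simp only [areaForm, Complex.re_ofReal_mul, Complex.im_ofReal_mul]; ring

theorem areaForm_mul_right (c : ℝ) (z w : ℂ) : areaForm z (c * w) = c * areaForm z w := by
  simp only [areaForm, Complex.re_ofReal_mul, Complex.im_ofReal_mul]; ring

theorem ConjDir.areaForm_pos (hN : ∀ z, N z = 0 → z = 0) {a b : ℝ} (h : ConjDir N a b) :
    0 < areaForm (polarPoint N a) (polarPoint N b) := by
  rw [areaForm_polarPoint]
  have := sin_pos_of_pos_of_lt_pi (x := b - a) (by linarith [h.1]) (by linarith [h.2.1])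
  have := radial_pos hN a
  have := radial_pos hN b
  positivity

theorem ConjDir.areaForm_le (hN : ∀ z, N z = 0 → z = 0) {a b : ℝ} (h : ConjDir N a b) (z : ℂ) :
    areaForm z (polarPoint N b) ≤ N z * areaForm (polarPoint N a) (polarPoint N b) := by
  conv_lhs => rw [eq_apply_mul_polarPoint_arg hN z, areaForm_mul_left]
  exact mul_le_mul_of_nonneg_left (h.2.2 _) (apply_nonneg N z)

theorem ConjDir.one_le (hN : ∀ z, N z = 0 → z = 0) {a b : ℝ} (h : ConjDir N a b) (c : ℝ) :
    1 ≤ N (polarPoint N a + c * polarPoint N b) := by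
  have h1 := h.areaForm_le hN (polarPoint N a + c * polarPoint N b)
  have h2 : areaForm (polarPoint N a + c * polarPoint N b) (polarPoint N b) =
      areaForm (polarPoint N a) (polarPoint N b) := by
    simp only [areaForm, Complex.add_re, Complex.add_im, Complex.re_ofReal_mul,
      Complex.im_ofReal_mul]; ring
  rw [h2] at h1
  exact one_le_of_le_mul_right₀ (h.areaForm_pos hN) h1

theorem areaForm_le_of_forall_le {x y : ℂ} (h : ∀ c : ℝ, 1 ≤ N (x + c * y))
    (hxy : 0 < areaForm x y) {z : ℂ} (hz : N z ≤ 1) : areaForm z y ≤ areaForm x y := by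
  by_contra! hlt
  set s := areaForm z y / areaForm x y with hs
  have hs1 : 1 < s := (one_lt_div hxy).2 hlt
  have h1 : z = s * (x + ((areaForm x z / areaForm x y / s : ℝ) : ℂ) * y) := by
    have h0 : areaForm x y ≠ 0 := hxy.ne'
    have : s ≠ 0 := by positivity
    rw [mul_add, ← mul_assoc, ← Complex.ofReal_mul, mul_div_cancel₀ _ this, hs]
    apply Complex.ext
    · simp only [Complex.add_re, Complex.re_ofReal_mul]
      field_simp
      simp only [areaForm]; ring
    · simp only [Complex.add_im, Complex.im_ofReal_mul]
      field_simp
      simp only [areaForm]; ring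
  rw [h1, N.map_ofReal_mul, abs_of_pos (by linarith)] at hz
  nlinarith [h (areaForm x z / areaForm x y / s)]

theorem exists_conjDir_of_forall_le (hN : ∀ z, N z = 0 → z = 0) {x y : ℂ} (hx : N x = 1)
    (hy : N y = 1) (h : ∀ c : ℝ, 1 ≤ N (x + c * y)) (hxy : 0 < areaForm x y) :
    ∃ a b, ConjDir N a b ∧ polarPoint N a = x ∧ polarPoint N b = y := by
  have hx0 : x ≠ 0 := by rintro rfl; simp at hx
  have hy0 : y ≠ 0 := by rintro rfl; simp at hy
  have key : ∀ z : ℂ, N z = 1 → ∀ θ c : ℝ, 0 < c → z = c * Complex.exp (θ * Complex.I) →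
      polarPoint N θ = z := fun z hz θ c hc h => by
    have := polar_eq_of_eq_mul hN hc h
    rw [hz] at this
    simpa using this.symm
  have hxa := key x hx x.arg ‖x‖ (norm_pos_iff.2 hx0) (Complex.norm_mul_exp_arg_mul_I x).symm
  have hq : 0 < (y / x).im := by
    have : (y / x).im = areaForm x y / Complex.normSq x := by
      rw [Complex.div_im, areaForm]; ring
    rw [this]
    exact div_pos hxy (Complex.normSq_pos.2 hx0)
  have hyb := key y hy (x.arg + (y / x).arg) (‖x‖ * ‖y / x‖)
    (mul_pos (norm_pos_iff.2 hx0) (norm_pos_iff.2 (div_ne_zero hy0 hx0))) (by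
    push_cast
    rw [add_mul, Complex.exp_add]
    calc y = x * (y / x) := by field_simp
      _ = (‖x‖ * Complex.exp (x.arg * Complex.I)) *
          (‖y / x‖ * Complex.exp ((y / x).arg * Complex.I)) := by
        rw [Complex.norm_mul_exp_arg_mul_I, Complex.norm_mul_exp_arg_mul_I]
      _ = _ := by ring)
  have harg : 0 < (y / x).arg ∧ (y / x).arg < π := by
    constructor
    · refine (Complex.arg_nonneg_iff.2 hq.le).lt_of_ne fun h0 => ?_
      exact hq.ne' (Complex.arg_eq_zero_iff.1 h0.symm).2
    · exact Complex.arg_lt_pi_iff.2 (Or.inr hq.ne')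
  refine ⟨_, _, ⟨by linarith [harg.1], by linarith [harg.2], fun s => ?_⟩, hxa, hyb⟩
  rw [hxa, hyb]
  exact areaForm_le_of_forall_le h hxy (apply_polarPoint hN s).le

theorem ConjDir.sin_mul_sin_nonneg (hN : ∀ z, N z = 0 → z = 0) {a₁ b₁ a₂ b₂ : ℝ}
    (h₁ : ConjDir N a₁ b₁) (h₂ : ConjDir N a₂ b₂) (h0 : a₁ + b₁ ≤ a₂ + b₂)
    (hπ : a₂ + b₂ < a₁ + b₁ + π) : 0 ≤ sin (a₂ - a₁) * sin (b₂ - b₁) := by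
  have e1 := h₁.2.2 a₂
  have e2 := h₂.2.2 a₁
  simp only [areaForm_polarPoint] at e1 e2
  have p1 := radial_pos hN a₁
  have p2 := radial_pos hN a₂
  have q1 := radial_pos hN b₁
  have q2 := radial_pos hN b₂
  have s1 : 0 < sin (b₁ - a₁) :=
    sin_pos_of_pos_of_lt_pi (by linarith [h₁.1]) (by linarith [h₁.2.1])
  have s2 : 0 < sin (b₂ - a₂) :=
    sin_pos_of_pos_of_lt_pi (by linarith [h₂.1]) (by linarith [h₂.2.1])
  have e1' : radial N a₂ * sin (b₁ - a₂) ≤ radial N a₁ * sin (b₁ - a₁) := by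
    nlinarith
  have e2' : radial N a₁ * sin (b₂ - a₁) ≤ radial N a₂ * sin (b₂ - a₂) := by
    nlinarith
  have hA : sin (b₁ - a₂) * sin (b₂ - a₁) ≤ sin (b₁ - a₁) * sin (b₂ - a₂) := by
    rcases le_or_gt 0 (sin (b₁ - a₂)) with hs | hs
    · rcases le_or_gt 0 (sin (b₂ - a₁)) with ht | ht
      · have := mul_le_mul e1' e2' (by positivity) (by positivity)
        have hp : 0 < radial N a₁ * radial N a₂ := by positivity
        nlinarith
      · nlinarith
    · rcases le_or_gt 0 (sin (b₂ - a₁)) with ht | ht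
      · nlinarith
      · exfalso
        have l1 : b₁ < a₂ := by
          by_contra! hle
          exact hs.not_ge (sin_nonneg_of_nonneg_of_le_pi (by linarith)
            (by linarith [h₁.1, h₁.2.1, h₂.1, h₂.2.1]))
        have l2 : a₁ + π < b₂ := by
          by_contra! hle
          exact ht.not_ge (sin_nonneg_of_nonneg_of_le_pi
            (by linarith [h₁.1, h₁.2.1, h₂.1, h₂.2.1]) (by linarith))
        linarith
  have : sin (a₂ - a₁) * sin (b₂ - b₁) =
      sin (b₁ - a₁) * sin (b₂ - a₂) - sin (b₁ - a₂) * sin (b₂ - a₁) := by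
    simp only [sin_sub]
    ring
  linarith

theorem ConjDir.le_of_add_le (hN : ∀ z, N z = 0 → z = 0) {a₁ b₁ a₂ b₂ : ℝ}
    (h₁ : ConjDir N a₁ b₁) (h₂ : ConjDir N a₂ b₂) (h0 : a₁ + b₁ ≤ a₂ + b₂) :
    a₁ ≤ a₂ ∧ b₁ ≤ b₂ := by
  obtain ⟨u1, v1, -⟩ := id h₁
  obtain ⟨u2, v2, -⟩ := id h₂
  rcases lt_or_ge (a₂ + b₂) (a₁ + b₁ + π) with hπ | hπ
  · have := h₁.sin_mul_sin_nonneg hN h₂ h0 hπ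
    constructor
    · by_contra! hlt
      have s1 : sin (a₂ - a₁) < 0 := sin_neg_of_neg_of_neg_pi_lt (by linarith) (by linarith)
      have s2 : 0 < sin (b₂ - b₁) := sin_pos_of_pos_of_lt_pi (by linarith) (by linarith)
      nlinarith
    · by_contra! hlt
      have s1 : sin (b₂ - b₁) < 0 := sin_neg_of_neg_of_neg_pi_lt (by linarith) (by linarith)
      have s2 : 0 < sin (a₂ - a₁) := sin_pos_of_pos_of_lt_pi (by linarith) (by linarith)
      nlinarith
  · constructor <;> linarith

theorem exists_conjDir (hN : ∀ z, N z = 0 → z = 0) (τ : ℝ) : ∃ a, ConjDir N a (τ - a) := by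
  have hcont : Continuous fun s => radial N s ^ 2 * sin (τ - 2 * s) :=
    ((locallyLipschitz_radial hN).continuous.pow 2).mul (by fun_prop)
  have hper : Function.Periodic (fun s => radial N s ^ 2 * sin (τ - 2 * s)) π := fun s => by
    simp only [radial_add_pi]
    rw [show τ - 2 * (s + π) = τ - 2 * s - 2 * π by ring, sin_sub_two_pi]
  obtain ⟨a, ha, hmax⟩ := (isCompact_Icc (a := (τ - π) / 2) (b := (τ - π) / 2 + π)).exists_isMaxOn
    (nonempty_Icc.2 (by linarith [pi_pos])) hcont.continuousOn
  have hmax' : ∀ s, radial N s ^ 2 * sin (τ - 2 * s) ≤ radial N a ^ 2 * sin (τ - 2 * a) := by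
    intro s
    obtain ⟨s', hs', he⟩ := hper.exists_mem_Ico pi_pos s ((τ - π) / 2)
    rw [he]
    exact hmax (Ico_subset_Icc_self hs')
  have hsin : 0 < sin (τ - 2 * a) := by
    have h1 := hmax' (τ / 2 - π / 4)
    rw [show τ - 2 * (τ / 2 - π / 4) = π / 2 by ring, sin_pi_div_two] at h1
    have h2 : 0 < radial N a ^ 2 * sin (τ - 2 * a) :=
      lt_of_lt_of_le (by have := radial_pos hN (τ / 2 - π / 4); positivity) h1
    exact pos_of_mul_pos_right h2 (by positivity)
  have hab : 0 < τ - 2 * a := by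
    by_contra! hle
    exact hsin.not_ge (sin_nonpos_of_nonpos_of_neg_pi_le hle (by linarith [ha.2]))
  have hab' : τ - 2 * a < π := by
    refine lt_of_le_of_ne (by linarith [ha.1]) fun h => ?_
    rw [h, sin_pi] at hsin
    exact hsin.false
  have pa := radial_pos hN a
  have pb := radial_pos hN (τ - a)
  set Q : ℂ → ℝ := fun z => 2 * z.re * z.im * (-cos τ) + (z.re ^ 2 - z.im ^ 2) * sin τ with hQ
  have hQle : ∀ z, Q z ≤ radial N a ^ 2 * sin (τ - 2 * a) * N z ^ 2 := by
    intro z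
    have hz := eq_apply_mul_polarPoint_arg hN z
    have : Q z = N z ^ 2 * (radial N z.arg ^ 2 * sin (τ - 2 * z.arg)) := by
      conv_lhs => rw [hz]
      simp only [hQ, polarPoint, Complex.re_ofReal_mul, Complex.im_ofReal_mul,
        Complex.exp_ofReal_mul_I_re, Complex.exp_ofReal_mul_I_im, sin_sub, sin_two_mul,
        cos_two_mul']
      ring
    rw [this, mul_comm _ (N z ^ 2)]
    exact mul_le_mul_of_nonneg_left (hmax' _) (sq_nonneg _)
  have hline : ∀ h : ℝ, 1 - h ^ 2 ≤
      N (polarPoint N a + h * (radial N a * Complex.exp ((τ - a : ℝ) * Complex.I))) ^ 2 := by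
    intro h
    have h1 := hQle (polarPoint N a + h * (radial N a * Complex.exp ((τ - a : ℝ) * Complex.I)))
    have h2 : Q (polarPoint N a + h * (radial N a * Complex.exp ((τ - a : ℝ) * Complex.I))) =
        radial N a ^ 2 * sin (τ - 2 * a) * (1 - h ^ 2) := by
      simp only [hQ, polarPoint, Complex.add_re, Complex.add_im, Complex.re_ofReal_mul,
        Complex.im_ofReal_mul, Complex.exp_ofReal_mul_I_re, Complex.exp_ofReal_mul_I_im]
      obtain ⟨b, rfl⟩ : ∃ b, τ = a + b := ⟨τ - a, by ring⟩
      rw [show a + b - a = b by ring, show a + b - 2 * a = b - a by ring]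
      simp only [sin_add, cos_add, sin_sub]
      have ea := sin_sq_add_cos_sq a
      have eb := sin_sq_add_cos_sq b
      linear_combination radial N a ^ 2 * (cos a * sin b - sin a * cos b) * ea +
        radial N a ^ 2 * h ^ 2 * (sin a * cos b - cos a * sin b) * eb
    rw [h2] at h1
    exact le_of_mul_le_mul_left h1 (by positivity)
  have hBJ : ∀ c : ℝ, 1 ≤
      N (polarPoint N a + c * (radial N a * Complex.exp ((τ - a : ℝ) * Complex.I))) := by
    intro c
    set w := (radial N a * Complex.exp ((τ - a : ℝ) * Complex.I) : ℂ)
    by_contra! hlt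
    obtain ⟨δ, hδ⟩ : ∃ δ, δ = 1 - N (polarPoint N a + c * w) := ⟨_, rfl⟩
    have hδ0 : 0 < δ := by linarith
    have hδ1 : δ ≤ 1 := by linarith [apply_nonneg N (polarPoint N a + c * w)]
    have conv : ∀ t : ℝ, 0 ≤ t → t ≤ 1 → 1 - (t * c) ^ 2 ≤ (1 - t * δ) ^ 2 := by
      intro t ht ht1
      refine (hline (t * c)).trans ?_
      refine pow_le_pow_left₀ (apply_nonneg N _) ?_ 2
      have : polarPoint N a + ((t * c : ℝ) : ℂ) * w =
          ((1 - t : ℝ) : ℂ) * polarPoint N a + (t : ℂ) * (polarPoint N a + c * w) := by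
        push_cast; ring
      rw [this]
      refine (map_add_le_add N _ _).trans_eq ?_
      rw [N.map_ofReal_mul, N.map_ofReal_mul, apply_polarPoint hN, abs_of_nonneg ht,
        abs_of_nonneg (by linarith), show N (polarPoint N a + c * w) = 1 - δ by linarith]
      ring
    have h1 := conv 1 zero_le_one le_rfl
    have hpos : 0 < c ^ 2 + δ ^ 2 := by positivity
    have h2 := conv (δ / (c ^ 2 + δ ^ 2)) (by positivity) ((div_le_one hpos).2 (by nlinarith))
    have h3 : δ / (c ^ 2 + δ ^ 2) * (c ^ 2 + δ ^ 2) = δ := div_mul_cancel₀ _ hpos.ne'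
    have h4 : 0 < δ / (c ^ 2 + δ ^ 2) := by positivity
    generalize δ / (c ^ 2 + δ ^ 2) = t at h2 h3 h4
    have : t * (2 * δ) ≤ t * (t * (c ^ 2 + δ ^ 2)) := by nlinarith
    rw [h3] at this
    nlinarith
  refine ⟨a, by linarith, by linarith, fun s => ?_⟩
  refine areaForm_le_of_forall_le (fun c => ?_) ?_
    (apply_polarPoint hN s).le
  · convert hBJ (c * radial N (τ - a) / radial N a) using 3
    rw [polarPoint]
    have : (radial N a : ℂ) ≠ 0 := by exact_mod_cast pa.ne'
    push_cast
    field_simp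
  · rw [areaForm_polarPoint, show τ - a - a = τ - 2 * a by ring]
    positivity

theorem exists_conjDir_parametrization (hN : ∀ z, N z = 0 → z = 0) :
    ∃ α β : ℝ → ℝ, (∀ t, ConjDir N (α t) (β t)) ∧ (∀ t, α t + β t = t) ∧ Monotone α ∧
      Monotone β ∧ LocallyLipschitz α ∧ LocallyLipschitz β ∧
      (∀ a b, ConjDir N a b → α (a + b) = a ∧ β (a + b) = b) ∧ ∀ θ, ∃ t, α t = θ := by
  choose α hα using exists_conjDir hN
  have hadd : ∀ t, α t + (t - α t) = t := fun t => by ring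
  have hmono : ∀ s t, s ≤ t → α s ≤ α t ∧ s - α s ≤ t - α t := fun s t hst =>
    (hα s).le_of_add_le hN (hα t) (by rw [hadd, hadd]; exact hst)
  have hLα : LipschitzWith 1 α := LipschitzWith.of_le_add fun s t => by
    rcases le_total s t with h | h
    · have := (hmono s t h).1
      have := dist_nonneg (x := s) (y := t)
      linarith
    · have := (hmono t s h).2
      have := le_abs_self (s - t)
      rw [Real.dist_eq]
      linarith
  have hLβ : LipschitzWith 1 fun t => t - α t := LipschitzWith.of_le_add fun s t => by
    rcases le_total s t with h | h
    · have := (hmono s t h).2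
      have := dist_nonneg (x := s) (y := t)
      linarith
    · have := (hmono t s h).1
      have := le_abs_self (s - t)
      rw [Real.dist_eq]
      linarith
  refine ⟨α, fun t => t - α t, hα, hadd, fun s t h => (hmono s t h).1, fun s t h => (hmono s t h).2,
    hLα.locallyLipschitz, hLβ.locallyLipschitz, fun a b hab => ?_, fun θ => ?_⟩
  · have h1 := hab.le_of_add_le hN (hα (a + b)) (hadd _).ge
    have h2 := (hα (a + b)).le_of_add_le hN hab (hadd _).le
    exact ⟨le_antisymm h2.1 h1.1, le_antisymm h2.2 h1.2⟩
  · have h1 := (hα (2 * θ)).1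
    have h2 := (hα (2 * θ + π)).2.1
    obtain ⟨t, -, ht⟩ := intermediate_value_Icc (by linarith [pi_pos] : 2 * θ ≤ 2 * θ + π)
      hLα.continuous.continuousOn (⟨by linarith, by linarith⟩ : θ ∈ Icc (α (2 * θ)) (α (2 * θ + π)))
    exact ⟨t, ht⟩

theorem ConjDir.add_pi {a b : ℝ} (h : ConjDir N a b) : ConjDir N (a + π) (b + π) := by
  refine ⟨by linarith [h.1], by linarith [h.2.1], fun s => ?_⟩
  have := h.2.2 (s + π)
  simp only [polarPoint_add_pi] at this ⊢
  simpa [areaForm, sub_eq_add_neg, add_comm] using this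

theorem hasDerivAt_exp_ofReal_mul_I {f : ℝ → ℝ} {f' t : ℝ} (hf : HasDerivAt f f' t) :
    HasDerivAt (fun s => Complex.exp (f s * Complex.I))
      (Complex.exp (f t * Complex.I) * (f' * Complex.I)) t :=
  (hf.ofReal_comp.mul_const Complex.I).cexp

theorem exists_hasDerivAt_polarPoint {f : ℝ → ℝ} {f' t : ℝ} (hf : HasDerivAt f f' t)
    (hr : DifferentiableAt ℝ (fun s => radial N (f s)) t) :
    ∃ x', HasDerivAt (fun s => polarPoint N (f s)) x' t ∧
      areaForm (polarPoint N (f t)) x' = radial N (f t) ^ 2 * f' := by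
  refine ⟨_, hr.hasDerivAt.ofReal_comp.mul (hasDerivAt_exp_ofReal_mul_I hf), ?_⟩
  simp only [areaForm, polarPoint, Complex.add_re, Complex.add_im, Complex.mul_re, Complex.mul_im,
    Complex.exp_ofReal_mul_I_re,
    Complex.exp_ofReal_mul_I_im, Complex.I_re, Complex.I_im, Complex.ofReal_re, Complex.ofReal_im]
  linear_combination radial N (f t) ^ 2 * f' * sin_sq_add_cos_sq (f t)

theorem ConjDir.areaForm_deriv_eq_zero {f : ℝ → ℝ} {x' : ℂ} {t b : ℝ}
    (hf : HasDerivAt (fun s => polarPoint N (f s)) x' t) (h : ConjDir N (f t) b) :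
    areaForm x' (polarPoint N b) = 0 := by
  have h1 := hf.areaForm (hasDerivAt_const t (polarPoint N b))
  have h2 : IsLocalMax (fun s => areaForm (polarPoint N (f s)) (polarPoint N b)) t :=
    Eventually.of_forall fun s => h.2.2 _
  simpa [areaForm] using h2.hasDerivAt_eq_zero h1

theorem LocallyLipschitz.polarPoint (hN : ∀ z, N z = 0 → z = 0) {f : ℝ → ℝ}
    (hf : LocallyLipschitz f) : LocallyLipschitz fun t => polarPoint N (f t) := by
  have h1 : LocallyLipschitz fun t => (radial N (f t), f t) :=
    ((locallyLipschitz_radial hN).comp hf).prodMk hf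
  refine h1.comp_contDiffAt (f := fun p : ℝ × ℝ => (p.1 : ℂ) * Complex.exp (p.2 * Complex.I))
    fun t => ContDiff.contDiffAt ?_
  have h2 : ContDiff ℝ 1 fun p : ℝ × ℝ => (p.1 : ℂ) := Complex.ofRealCLM.contDiff.comp contDiff_fst
  have h3 : ContDiff ℝ 1 fun p : ℝ × ℝ => (p.2 : ℂ) := Complex.ofRealCLM.contDiff.comp contDiff_snd
  fun_prop

theorem ae_exists_hasDerivAt_polarPoint (hN : ∀ z, N z = 0 → z = 0) {f : ℝ → ℝ}
    (hf : LocallyLipschitz f) (hmono : Monotone f) :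
    ∀ᵐ t, ∃ f' x', 0 ≤ f' ∧ HasDerivAt f f' t ∧ HasDerivAt (fun s => polarPoint N (f s)) x' t ∧
      areaForm (polarPoint N (f t)) x' = radial N (f t) ^ 2 * f' := by
  filter_upwards [hf.ae_differentiableAt,
    ((locallyLipschitz_radial hN).comp hf).ae_differentiableAt] with t h1 h2
  obtain ⟨x', hx, hx'⟩ := exists_hasDerivAt_polarPoint h1.hasDerivAt h2
  exact ⟨_, x', hmono.deriv_nonneg, h1.hasDerivAt, hx, hx'⟩

/-- Twice the area of the sector of the unit ball of `N` between the directions `0` and `θ`. -/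
noncomputable def sectorArea (N : Seminorm ℝ ℂ) (θ : ℝ) : ℝ := ∫ s in (0 : ℝ)..θ, radial N s ^ 2

theorem hasDerivAt_sectorArea (hN : ∀ z, N z = 0 → z = 0) (θ : ℝ) :
    HasDerivAt (sectorArea N) (radial N θ ^ 2) θ :=
  (((locallyLipschitz_radial hN).continuous.pow 2).integral_hasStrictDerivAt 0 θ).hasDerivAt

theorem contDiff_sectorArea (hN : ∀ z, N z = 0 → z = 0) : ContDiff ℝ 1 (sectorArea N) := by
  refine contDiff_one_iff_deriv.2 ⟨fun θ => (hasDerivAt_sectorArea hN θ).differentiableAt, ?_⟩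
  rw [show deriv (sectorArea N) = fun θ => radial N θ ^ 2 from
    funext fun θ => (hasDerivAt_sectorArea hN θ).deriv]
  exact (locallyLipschitz_radial hN).continuous.pow 2

theorem sectorArea_add_pi (hN : ∀ z, N z = 0 → z = 0) (θ : ℝ) :
    sectorArea N (θ + π) = sectorArea N θ + sectorArea N π := by
  have hc := (locallyLipschitz_radial hN).continuous.pow 2
  have hp : Function.Periodic (fun s => radial N s ^ 2) π := fun s => by simp only [radial_add_pi]
  have h1 := hp.intervalIntegral_add_eq θ 0
  rw [zero_add] at h1
  rw [sectorArea, sectorArea, sectorArea, ← h1]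
  exact (intervalIntegral.integral_add_adjacent_intervals (hc.intervalIntegrable _ _)
    (hc.intervalIntegrable _ _)).symm

/-- A choice of argument of `u`, continuous as long as `u` stays on the positive side of the
direction `a`. -/
noncomputable def liftArg (a : ℝ) (u : ℂ) : ℝ :=
  a + (Complex.log (u * Complex.exp (-(a * Complex.I)))).im

theorem norm_mul_exp_liftArg (a : ℝ) (u : ℂ) :
    (‖u‖ : ℂ) * Complex.exp (liftArg a u * Complex.I) = u := by
  have h1 : ‖u * Complex.exp (-(a * Complex.I))‖ = ‖u‖ := by
    rw [norm_mul, show -((a : ℂ) * Complex.I) = ((-a : ℝ) : ℂ) * Complex.I by push_cast; ring,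
      Complex.norm_exp_ofReal_mul_I, mul_one]
  have h2 := Complex.norm_mul_exp_arg_mul_I (u * Complex.exp (-(a * Complex.I)))
  rw [h1] at h2
  rw [liftArg, Complex.log_im]
  push_cast
  rw [add_mul, Complex.exp_add, mul_left_comm, h2, mul_left_comm, ← Complex.exp_add,
    add_neg_cancel, Complex.exp_zero, mul_one]

theorem radial_liftArg (a : ℝ) {u : ℂ} (hu : u ≠ 0) : radial N (liftArg a u) = ‖u‖ / N u := by
  have h0 : (‖u‖ : ℝ) ≠ 0 := norm_ne_zero_iff.2 hu
  have h1 : N u = ‖u‖ * N (Complex.exp (liftArg a u * Complex.I)) := by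
    conv_lhs => rw [← norm_mul_exp_liftArg a u, N.map_ofReal_mul, abs_of_nonneg (norm_nonneg u)]
  rw [radial, h1]
  field_simp

theorem hasDerivAt_liftArg {f : ℝ → ℝ} {f' t : ℝ} {u : ℝ → ℂ} {u' : ℂ} (hf : HasDerivAt f f' t)
    (hu : HasDerivAt u u' t)
    (hmem : u t * Complex.exp (-(f t * Complex.I)) ∈ Complex.slitPlane) :
    HasDerivAt (fun s => liftArg (f s) (u s)) (areaForm (u t) u' / ‖u t‖ ^ 2) t := by
  have hu0 : u t ≠ 0 := fun h => by simp [h] at hmem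
  have h1 := (hu.mul (hf.ofReal_comp.mul_const Complex.I).neg.cexp).clog_real hmem
  have h2 := hf.add (Complex.imCLM.hasFDerivAt.comp_hasDerivAt t h1)
  refine h2.congr_deriv ?_
  have hq : (u' * Complex.exp (-(f t * Complex.I)) +
      u t * (Complex.exp (-(f t * Complex.I)) * -(f' * Complex.I))) /
      (u t * Complex.exp (-(f t * Complex.I))) = u' / u t - f' * Complex.I := by
    have := Complex.exp_ne_zero (-(f t * Complex.I))
    field_simp
    ring
  simp only [Complex.imCLM_apply, Pi.mul_apply, Pi.neg_apply]
  rw [hq, ← Complex.normSq_eq_norm_sq, Complex.sub_im, Complex.div_im]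
  simp only [areaForm, Complex.im_ofReal_mul, Complex.I_im]
  ring

theorem locallyLipschitz_liftArg {f : ℝ → ℝ} {u : ℝ → ℂ} (hf : LocallyLipschitz f)
    (hu : LocallyLipschitz u)
    (hmem : ∀ t, u t * Complex.exp (-(f t * Complex.I)) ∈ Complex.slitPlane) :
    LocallyLipschitz fun t => liftArg (f t) (u t) := by
  refine (hf.prodMk hu).comp_contDiffAt (f := fun p : ℝ × ℂ => liftArg p.1 p.2) fun t => ?_
  have h2 : ContDiff ℝ 1 fun p : ℝ × ℂ => (p.1 : ℂ) := Complex.ofRealCLM.contDiff.comp contDiff_fst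
  have h3 : ContDiff ℝ 1 fun p : ℝ × ℂ => p.2 * Complex.exp (-(p.1 * Complex.I)) := by fun_prop
  have h4 : ContDiffAt ℝ 1 (fun p : ℝ × ℂ => Complex.log (p.2 * Complex.exp (-(p.1 * Complex.I))))
      (f t, u t) := by
    have := (Complex.contDiffAt_log (n := 1) (hmem t)).restrict_scalars ℝ
    exact this.comp (f t, u t) h3.contDiffAt
  exact contDiffAt_fst.add (Complex.imCLM.contDiff.contDiffAt.comp _ h4)

theorem areaForm_add_left (x y z : ℂ) : areaForm (x + y) z = areaForm x z + areaForm y z := by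
  simp only [areaForm, Complex.add_re, Complex.add_im]; ring

theorem areaForm_add_right (x y z : ℂ) : areaForm x (y + z) = areaForm x y + areaForm x z := by
  simp only [areaForm, Complex.add_re, Complex.add_im]; ring

theorem areaForm_neg_left (x y : ℂ) : areaForm (-x) y = -areaForm x y := by
  simp only [areaForm, Complex.neg_re, Complex.neg_im]; ring

theorem areaForm_neg_right (x y : ℂ) : areaForm x (-y) = -areaForm x y := by
  simp only [areaForm, Complex.neg_re, Complex.neg_im]; ring

theorem areaForm_comm (x y : ℂ) : areaForm x y = -areaForm y x := by
  simp only [areaForm]; ring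

theorem areaForm_self (x : ℂ) : areaForm x x = 0 := by
  simp only [areaForm]; ring

theorem areaForm_plucker (x y z w : ℂ) :
    areaForm x y * areaForm z w - areaForm x z * areaForm y w + areaForm x w * areaForm y z = 0 := by
  simp only [areaForm]; ring

theorem areaForm_smul_sub (x y z : ℂ) :
    (areaForm x y : ℂ) * z = (areaForm z y : ℂ) * x + (areaForm x z : ℂ) * y := by
  apply Complex.ext <;>
  simp only [areaForm, Complex.add_re, Complex.add_im, Complex.re_ofReal_mul,
    Complex.im_ofReal_mul] <;> ring

/-- The norm `N` has rectangular constant at most `√2`. -/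
def RectangularLE (N : Seminorm ℝ ℂ) : Prop :=
  ∀ x y : ℂ, N x = 1 → N y = 1 → (∀ c : ℝ, 1 ≤ N (x + c * y)) →
    ∀ a b : ℝ, |a| + |b| ≤ √2 * N (a * x + b * y)

theorem RectangularLE.le_of_conjDir (hJ : RectangularLE N) (hN : ∀ z, N z = 0 → z = 0) {a b : ℝ}
    (h : ConjDir N a b) (c d : ℝ) :
    |c| + |d| ≤ √2 * N (c * polarPoint N a + d * polarPoint N b) :=
  hJ _ _ (apply_polarPoint hN a) (apply_polarPoint hN b) (h.one_le hN) c d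

theorem RectangularLE.sqrt_two_le_add (hJ : RectangularLE N) (hN : ∀ z, N z = 0 → z = 0) {a b : ℝ}
    (h : ConjDir N a b) : √2 ≤ N (polarPoint N a + polarPoint N b) := by
  have h1 := hJ.le_of_conjDir hN h 1 1
  simp only [abs_one, Complex.ofReal_one, one_mul] at h1
  have h2 : √2 * √2 = 2 := mul_self_sqrt zero_le_two
  have h3 : 0 < √2 := by positivity
  nlinarith

theorem RectangularLE.areaForm_add_pos (hJ : RectangularLE N) (hN : ∀ z, N z = 0 → z = 0)
    {a b c : ℝ} (h : ConjDir N a b) (h' : ConjDir N b c) :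
    0 < areaForm (polarPoint N a + polarPoint N b) (polarPoint N c) := by
  have hW := h'.areaForm_pos hN
  have h1 : 0 ≤ areaForm (polarPoint N a + polarPoint N b) (polarPoint N c) := by
    have := h'.areaForm_le hN (-polarPoint N a)
    rw [map_neg_eq_map, apply_polarPoint hN, areaForm_neg_left] at this
    rw [areaForm_add_left]
    linarith
  refine h1.lt_of_ne' fun h0 => ?_
  set x := polarPoint N a
  set y := polarPoint N b
  set z := polarPoint N c
  obtain ⟨k, hk⟩ : ∃ k : ℝ, x + y = k * z := by
    refine ⟨areaForm y (x + y) / areaForm y z, ?_⟩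
    have h2 := areaForm_smul_sub y z (x + y)
    have h3 : (areaForm y z : ℂ) ≠ 0 := by exact_mod_cast hW.ne'
    rw [h0, Complex.ofReal_zero, zero_mul, zero_add] at h2
    push_cast
    field_simp
    linear_combination h2
  have h4 := hJ.sqrt_two_le_add hN h
  have h5 := hJ.le_of_conjDir hN h' (-1) k
  have h6 : ((-1 : ℝ) : ℂ) * y + k * z = x := by
    push_cast
    linear_combination -hk
  change √2 ≤ N (x + y) at h4
  change _ ≤ √2 * N (((-1 : ℝ) : ℂ) * y + k * z) at h5
  rw [h6, show N x = 1 from apply_polarPoint hN a] at h5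
  rw [hk, N.map_ofReal_mul, show N z = 1 from apply_polarPoint hN c] at h4
  rw [abs_neg, abs_one] at h5
  linarith

theorem LocallyLipschitz.areaForm {x y : ℝ → ℂ} (hx : LocallyLipschitz x)
    (hy : LocallyLipschitz y) : LocallyLipschitz fun t => areaForm (x t) (y t) := by
  refine (hx.prodMk hy).comp_contDiffAt (f := fun p : ℂ × ℂ => _root_.areaForm p.1 p.2) fun t =>
    ContDiff.contDiffAt ?_
  have hre : ContDiff ℝ 1 Complex.re := Complex.reCLM.contDiff
  have him : ContDiff ℝ 1 Complex.im := Complex.imCLM.contDiff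
  exact ((hre.comp contDiff_fst).mul (him.comp contDiff_snd)).sub
    ((him.comp contDiff_fst).mul (hre.comp contDiff_snd))

theorem ConjDir.add_mul_exp_mem_slitPlane (hN : ∀ z, N z = 0 → z = 0) {a b : ℝ}
    (h : ConjDir N a b) :
    (polarPoint N a + polarPoint N b) * Complex.exp (-(a * Complex.I)) ∈ Complex.slitPlane := by
  refine Complex.mem_slitPlane_iff.2 (Or.inr (ne_of_gt ?_))
  have h1 := radial_pos hN b
  have h2 : 0 < sin (b - a) :=
    sin_pos_of_pos_of_lt_pi (by linarith [h.1]) (by linarith [h.2.1])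
  have h3 : ((polarPoint N a + polarPoint N b) * Complex.exp (-(a * Complex.I))).im =
      radial N b * sin (b - a) := by
    rw [show -((a : ℂ) * Complex.I) = ((-a : ℝ) : ℂ) * Complex.I by push_cast; ring,
      Complex.mul_im]
    simp only [polarPoint, Complex.add_re, Complex.add_im,
      Complex.exp_ofReal_mul_I_re, Complex.exp_ofReal_mul_I_im, Complex.re_ofReal_mul,
      Complex.im_ofReal_mul, cos_neg, sin_neg, sin_sub]
    ring
  rw [h3]
  positivity

theorem RectangularLE.apply_add_of_conjDir (hJ : RectangularLE N) (hN : ∀ z, N z = 0 → z = 0)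
    {a b : ℝ} (hab : ConjDir N a b) : N (polarPoint N a + polarPoint N b) = √2 := by
  obtain ⟨α, β, hc, hadd, hmα, hmβ, hLα, hLβ, huniq, hsurj⟩ := exists_conjDir_parametrization hN
  set x : ℝ → ℂ := fun t => polarPoint N (α t) with hx
  set y : ℝ → ℂ := fun t => polarPoint N (β t) with hy
  have hLx : LocallyLipschitz x := hLα.polarPoint hN
  have hLy : LocallyLipschitz y := hLβ.polarPoint hN
  have hLu : LocallyLipschitz fun t => x t + y t :=
    (hLx.prodMk hLy).comp_contDiffAt (f := fun p : ℂ × ℂ => p.1 + p.2) fun t =>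
      contDiffAt_fst.add contDiffAt_snd
  set φ : ℝ → ℝ := fun t => liftArg (α t) (x t + y t) with hφ
  have hmem : ∀ t, (x t + y t) * Complex.exp (-(α t * Complex.I)) ∈ Complex.slitPlane :=
    fun t => (hc t).add_mul_exp_mem_slitPlane hN
  have hLφ : LocallyLipschitz φ := locallyLipschitz_liftArg hLα hLu hmem
  have hLw : LocallyLipschitz fun t => areaForm (x t) (y t) :=
    hLx.areaForm hLy
  set H : ℝ → ℝ := fun t => sectorArea N (α t) + sectorArea N (β t) + areaForm (x t) (y t) -
    2 * sectorArea N (φ t) with hH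
  have hG := contDiff_sectorArea hN
  have hLH : LocallyLipschitz H := by
    refine ((hLα.prodMk hLβ).prodMk (hLw.prodMk hLφ)).comp_contDiffAt
      (f := fun p : (ℝ × ℝ) × (ℝ × ℝ) => sectorArea N p.1.1 + sectorArea N p.1.2 + p.2.1 -
        2 * sectorArea N p.2.2) fun t => ContDiff.contDiffAt ?_
    fun_prop
  have hu2 : ∀ t, √2 ≤ N (x t + y t) := fun t => hJ.sqrt_two_le_add hN (hc t)
  have hu0 : ∀ t, x t + y t ≠ 0 := fun t h => by
    have := hu2 t
    rw [h, map_zero] at this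
    exact this.not_gt (by positivity)
  have hderiv : ∀ᵐ t, ∃ k, 0 < k ∧ HasDerivAt H (k * (1 - 2 / N (x t + y t) ^ 2)) t := by
    filter_upwards [ae_exists_hasDerivAt_polarPoint hN hLα hmα,
      ae_exists_hasDerivAt_polarPoint hN hLβ hmβ] with t ⟨a', x', ha0, ha', hx', hax⟩
      ⟨b', y', hb0, hb', hy', hby⟩
    change HasDerivAt x x' t at hx'
    change HasDerivAt y y' t at hy'
    change areaForm (x t) x' = _ at hax
    change areaForm (y t) y' = _ at hby
    obtain ⟨s, hs⟩ := hsurj (β t)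
    have hz : ConjDir N (β t) (β s) := hs ▸ hc s
    have hab' : a' + b' = 1 := by
      have h1 := ha'.add hb'
      rw [show α + β = id from funext hadd] at h1
      exact h1.unique (hasDerivAt_id t)
    have hx'y : areaForm x' (y t) = 0 := ConjDir.areaForm_deriv_eq_zero hx' (hc t)
    have hy'z : areaForm y' (polarPoint N (β s)) = 0 := ConjDir.areaForm_deriv_eq_zero hy' hz
    have hW := hz.areaForm_pos hN
    have hpos := hJ.areaForm_add_pos hN (hc t) hz
    change 0 < areaForm (y t) _ at hW
    change 0 < areaForm (x t + y t) _ at hpos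
    have hk : areaForm (x t + y t) (x' + y') =
        areaForm (x t) x' + areaForm (y t) y' + areaForm (x t) y' := by
      rw [areaForm_add_left, areaForm_add_right, areaForm_add_right, areaForm_comm (y t) x', hx'y]
      ring
    refine ⟨areaForm (x t + y t) (x' + y'), ?_, ?_⟩
    · have h1 := areaForm_plucker (x t) (y t) y' (polarPoint N (β s))
      rw [areaForm_add_left] at hpos
      have h2 : areaForm (x t + y t) (x' + y') * areaForm (y t) (polarPoint N (β s)) =
          radial N (α t) ^ 2 * a' * areaForm (y t) (polarPoint N (β s)) + radial N (β t) ^ 2 * b' *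
          (areaForm (x t) (polarPoint N (β s)) + areaForm (y t) (polarPoint N (β s))) := by
        rw [hk, hax, ← hby]
        rw [hy'z] at h1
        linarith
      have hr := radial_pos hN (α t)
      have hr' := radial_pos hN (β t)
      refine pos_of_mul_pos_left (h2 ▸ ?_) hW.le
      rcases ha0.eq_or_lt with h0 | h0
      · have : b' = 1 := by linarith
        subst this
        exact add_pos_of_nonneg_of_pos (by positivity) (by positivity)
      · exact add_pos_of_pos_of_nonneg (by positivity) (by positivity)
    · have hφ' := hasDerivAt_liftArg ha' (hx'.add hy') (hmem t)
      have h1 := ((((hasDerivAt_sectorArea hN (α t)).comp t ha').add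
        ((hasDerivAt_sectorArea hN (β t)).comp t hb')).add (hx'.areaForm hy')).sub
        (((hasDerivAt_sectorArea hN (φ t)).comp t hφ').const_mul 2)
      refine h1.congr_deriv ?_
      have h2 : radial N (φ t) = ‖x t + y t‖ / N (x t + y t) := radial_liftArg _ (hu0 t)
      have h3 : ‖x t + y t‖ ≠ 0 := norm_ne_zero_iff.2 (hu0 t)
      have h4 : N (x t + y t) ≠ 0 := fun h => hu0 t (hN _ h)
      simp only [Pi.add_apply]
      rw [h2, ← hax, ← hby, hx'y, hk]
      field_simp
      ring
  have hfac : ∀ t, 0 ≤ 1 - 2 / N (x t + y t) ^ 2 := fun t => by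
    have h1 := hu2 t
    have h2 : (2 : ℝ) ≤ N (x t + y t) ^ 2 := by
      rw [← sq_sqrt (zero_le_two : (0 : ℝ) ≤ 2)]
      gcongr
    rw [sub_nonneg, div_le_one (by linarith)]
    exact h2
  have hmono : Monotone H := hLH.monotone_of_ae_hasDerivAt_nonneg <| hderiv.mono fun t ⟨k, hk, h⟩ =>
    ⟨_, mul_nonneg hk.le (hfac t), h⟩
  have hper : Function.Periodic H (2 * π) := fun t => by
    have h1 : α (t + 2 * π) = α t + π ∧ β (t + 2 * π) = β t + π := by
      have := huniq _ _ (hc t).add_pi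
      rwa [show α t + π + (β t + π) = t + 2 * π by linarith [hadd t]] at this
    have hx2 : x (t + 2 * π) = -x t := by simp only [hx, h1.1, polarPoint_add_pi]
    have hy2 : y (t + 2 * π) = -y t := by simp only [hy, h1.2, polarPoint_add_pi]
    have hφ2 : φ (t + 2 * π) = φ t + π := by
      simp only [hφ, hx2, hy2, h1.1, liftArg]
      have : (-x t + -y t) * Complex.exp (-(((α t + π : ℝ) : ℂ) * Complex.I)) =
          (x t + y t) * Complex.exp (-(α t * Complex.I)) := by
        rw [Complex.exp_neg, exp_add_pi_mul_I, inv_neg, ← Complex.exp_neg]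
        ring
      rw [this]
      ring
    simp only [hH, hx2, hy2, hφ2, h1.1, h1.2, sectorArea_add_pi hN, areaForm_neg_left,
      areaForm_neg_right]
    ring
  have hconst : ∀ s t, s ≤ t → H t = H s := fun s t hst => by
    refine le_antisymm ?_ (hmono hst)
    obtain ⟨n, hn⟩ := exists_nat_ge ((t - s) / (2 * π))
    rw [div_le_iff₀ (by positivity)] at hn
    rw [← hper.nat_mul n s]
    exact hmono (by linarith)
  have hconst' : H = fun _ => H 0 := funext fun t => by
    rcases le_total 0 t with h | h
    · exact hconst 0 t h
    · exact (hconst t 0 h).symm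
  have hae : (fun t => N (x t + y t)) =ᵐ[volume] fun _ => √2 := by
    filter_upwards [hderiv] with t ⟨k, hk, h⟩
    have h1 : k * (1 - 2 / N (x t + y t) ^ 2) = 0 := by
      rw [hconst'] at h
      exact h.unique (hasDerivAt_const t _)
    have h2 := (mul_eq_zero.1 h1).resolve_left hk.ne'
    have h4 : 0 < N (x t + y t) := lt_of_lt_of_le (by positivity) (hu2 t)
    have h3 : N (x t + y t) ^ 2 = 2 := by
      field_simp at h2
      linarith
    rw [← h3, sqrt_sq h4.le]
  obtain ⟨K, hK⟩ := N.exists_lipschitzWith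
  have heq := (Continuous.ae_eq_iff_eq volume (hK.continuous.comp hLu.continuous)
    continuous_const).1 hae
  have h1 := congrFun heq (a + b)
  have h2 := huniq a b hab
  simpa [hx, hy, h2.1, h2.2] using h1

theorem abs_areaForm_add_abs_areaForm_le (hJ : RectangularLE N)
    (hN : ∀ z, N z = 0 → z = 0) {a b : ℝ}
    (h : ConjDir N a b) (z : ℂ) :
    |areaForm z (polarPoint N b)| + |areaForm (polarPoint N a) z| ≤
      √2 * N z * areaForm (polarPoint N a) (polarPoint N b) := by
  have hW := h.areaForm_pos hN
  have h1 := hJ.le_of_conjDir hN h (areaForm z (polarPoint N b)) (areaForm (polarPoint N a) z)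
  rw [← areaForm_smul_sub, N.map_ofReal_mul, abs_of_pos hW] at h1
  linarith

/-- The seminorm `z ↦ N (conj z)`. -/
noncomputable def conjSeminorm (N : Seminorm ℝ ℂ) : Seminorm ℝ ℂ :=
  N.comp Complex.conjAe.toLinearMap

theorem conjSeminorm_apply (z : ℂ) : conjSeminorm N z = N (starRingEnd ℂ z) := rfl

theorem RectangularLE.conjSeminorm (hJ : RectangularLE N) : RectangularLE (conjSeminorm N) := by
  intro x y hx hy h a b
  have := hJ _ _ hx hy (fun c => by simpa [conjSeminorm_apply] using h c) a b
  simpa [conjSeminorm_apply] using this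

theorem RectangularLE.apply_sub_of_conjDir (hJ : RectangularLE N) (hN : ∀ z, N z = 0 → z = 0)
    {a b : ℝ} (hab : ConjDir N a b) : N (polarPoint N b - polarPoint N a) = √2 := by
  have hN' : ∀ z, _root_.conjSeminorm N z = 0 → z = 0 := fun z hz => by simpa using hN _ hz
  obtain ⟨a', b', h', ha', hb'⟩ := exists_conjDir_of_forall_le hN'
    (x := starRingEnd ℂ (polarPoint N a)) (y := -starRingEnd ℂ (polarPoint N b))
    (by rw [conjSeminorm_apply, Complex.conj_conj, apply_polarPoint hN])
    (by rw [map_neg_eq_map, conjSeminorm_apply, Complex.conj_conj, apply_polarPoint hN])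
    (fun c => by simpa [conjSeminorm_apply] using hab.one_le hN (-c))
    (by simpa [areaForm, sub_eq_add_neg, add_comm] using hab.areaForm_pos hN)
  have h1 := hJ.conjSeminorm.apply_add_of_conjDir hN' h'
  rw [ha', hb', conjSeminorm_apply, map_add, map_neg, Complex.conj_conj, Complex.conj_conj] at h1
  rw [← h1, ← map_neg_eq_map N]
  congr 1
  ring

theorem areaForm_deriv_eq_zero_of_forall_le {p : ℝ → ℂ} {p' w : ℂ} {t : ℝ}
    (hp : HasDerivAt p p' t) (h : ∀ s, areaForm (p s) w ≤ areaForm (p t) w) :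
    areaForm p' w = 0 := by
  have h1 := hp.areaForm (hasDerivAt_const t w)
  have h2 : IsLocalMax (fun s => areaForm (p s) w) t := Eventually.of_forall h
  simpa [areaForm] using h2.hasDerivAt_eq_zero h1

theorem RectangularLE.exists_eq_areaForm_sq (hJ : RectangularLE N) (hN : ∀ z, N z = 0 → z = 0) :
    ∃ x y : ℂ, ∃ W : ℝ, W ≠ 0 ∧ ∀ z, W ^ 2 * N z ^ 2 = areaForm z y ^ 2 + areaForm z x ^ 2 := by
  obtain ⟨α, β, hc, hadd, hmα, hmβ, hLα, hLβ, huniq, hsurj⟩ := exists_conjDir_parametrization hN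
  set x : ℝ → ℂ := fun t => polarPoint N (α t) with hx
  set y : ℝ → ℂ := fun t => polarPoint N (β t) with hy
  have hLx : LocallyLipschitz x := hLα.polarPoint hN
  have hLy : LocallyLipschitz y := hLβ.polarPoint hN
  have hW : ∀ t, 0 < areaForm (x t) (y t) := fun t => (hc t).areaForm_pos hN
  have h2 : √2 * √2 = 2 := mul_self_sqrt zero_le_two
  have hderiv : ∀ᵐ t, ∃ (k : ℝ) (x' y' : ℂ), HasDerivAt x x' t ∧ HasDerivAt y y' t ∧
      (areaForm (x t) (y t) : ℂ) * x' = (k : ℂ) * y t ∧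
      (areaForm (x t) (y t) : ℂ) * y' = -(k : ℂ) * x t := by
    filter_upwards [ae_exists_hasDerivAt_polarPoint hN hLα hmα,
      ae_exists_hasDerivAt_polarPoint hN hLβ hmβ] with t ⟨_, x', _, _, hx', _⟩
      ⟨_, y', _, _, hy', _⟩
    change HasDerivAt x x' t at hx'
    change HasDerivAt y y' t at hy'
    have e1 : areaForm x' (y t) = 0 := ConjDir.areaForm_deriv_eq_zero hx' (hc t)
    have hle : ∀ z, N z = √2 →
        |areaForm z (y t)| + |areaForm (x t) z| ≤ 2 * areaForm (x t) (y t) := fun z hz => by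
      have := abs_areaForm_add_abs_areaForm_le hJ hN (hc t) z
      rwa [hz, h2] at this
    have e2 : areaForm (x' + y') (y t + -x t) = 0 := by
      refine areaForm_deriv_eq_zero_of_forall_le (hx'.add hy') fun s => ?_
      have h3 := hle (x s + y s) (hJ.apply_add_of_conjDir hN (hc s))
      have h4 := le_abs_self (areaForm (x s + y s) (y t))
      have h5 := le_abs_self (areaForm (x t) (x s + y s))
      simp only [Pi.add_apply]
      have h6 : areaForm (x t + y t) (y t + -x t) = 2 * areaForm (x t) (y t) := by
        simp only [_root_.areaForm, Complex.neg_re, Complex.neg_im, Complex.add_re, Complex.add_im]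
        ring
      rw [h6, areaForm_add_right, areaForm_neg_right, areaForm_comm _ (x t)]
      linarith
    have e3 : areaForm (y' - x') (-(x t + y t)) = 0 := by
      refine areaForm_deriv_eq_zero_of_forall_le (hy'.sub hx') fun s => ?_
      have h3 := hle (y s - x s) (hJ.apply_sub_of_conjDir hN (hc s))
      have h4 := neg_abs_le (areaForm (y s - x s) (y t))
      have h5 := le_abs_self (areaForm (x t) (y s - x s))
      simp only [Pi.sub_apply]
      rw [areaForm_neg_right, areaForm_add_right, areaForm_comm _ (x t)]
      have h6 : areaForm (y t - x t) (-(x t + y t)) = 2 * areaForm (x t) (y t) := by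
        simp only [_root_.areaForm, Complex.sub_re, Complex.sub_im, Complex.neg_re, Complex.neg_im,
          Complex.add_re, Complex.add_im]
        ring
      rw [h6]
      linarith
    have e4 : areaForm (x t) y' = 0 := by
      simp only [_root_.areaForm, Complex.sub_re, Complex.sub_im, Complex.neg_re, Complex.neg_im,
          Complex.add_re, Complex.add_im] at e1 e2 e3 ⊢
      linarith
    have e5 : areaForm y' (y t) = -areaForm (x t) x' := by
      simp only [_root_.areaForm, Complex.sub_re, Complex.sub_im, Complex.neg_re, Complex.neg_im,
          Complex.add_re, Complex.add_im] at e1 e2 e3 e4 ⊢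
      linarith
    refine ⟨areaForm (x t) x', x', y', hx', hy', ?_, ?_⟩
    · rw [areaForm_smul_sub, e1]
      simp
    · rw [areaForm_smul_sub, e4, e5]
      simp
  have hWconst : ∀ t, areaForm (x t) (y t) = areaForm (x 0) (y 0) := fun t => by
    refine (hLx.areaForm hLy).eq_of_ae_hasDerivAt_zero ?_ t 0
    filter_upwards [hderiv] with s ⟨k, x', y', hx', hy', h3, h4⟩
    refine (hx'.areaForm hy').congr_deriv ?_
    refine (mul_eq_zero.1 ?_).resolve_left (hW s).ne'
    rw [mul_add, ← areaForm_mul_left, ← areaForm_mul_right, h3, h4, ← Complex.ofReal_neg,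
      areaForm_mul_left, areaForm_mul_right, areaForm_self, areaForm_self]
    ring
  have hE : ∀ z t, areaForm z (y t) ^ 2 + areaForm z (x t) ^ 2 =
      areaForm z (y 0) ^ 2 + areaForm z (x 0) ^ 2 := fun z t => by
    have hL : LocallyLipschitz fun t => areaForm z (y t) ^ 2 + areaForm z (x t) ^ 2 := by
      have hz : LocallyLipschitz fun _ : ℝ => z := LocallyLipschitz.const z
      exact ((hz.areaForm hLy).prodMk (hz.areaForm hLx)).comp_contDiffAt
        (f := fun p : ℝ × ℝ => p.1 ^ 2 + p.2 ^ 2) fun t => by fun_prop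
    refine hL.eq_of_ae_hasDerivAt_zero ?_ t 0
    filter_upwards [hderiv] with s ⟨k, x', y', hx', hy', h3, h4⟩
    have hz := hasDerivAt_const s z
    refine (((hz.areaForm hy').pow 2).add ((hz.areaForm hx').pow 2)).congr_deriv ?_
    refine (mul_eq_zero.1 ?_).resolve_left (hW s).ne'
    have h5 : areaForm (x s) (y s) * areaForm z x' = k * areaForm z (y s) := by
      rw [← areaForm_mul_right, h3, areaForm_mul_right]
    have h6 : areaForm (x s) (y s) * areaForm z y' = -k * areaForm z (x s) := by
      rw [← areaForm_mul_right, h4, ← Complex.ofReal_neg, areaForm_mul_right]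
    have h7 : ∀ w, areaForm 0 w = 0 := fun w => by simp [_root_.areaForm]
    simp only [h7]
    push_cast
    linear_combination 2 * areaForm z (x s) * h5 + 2 * areaForm z (y s) * h6
  refine ⟨x 0, y 0, areaForm (x 0) (y 0), (hW 0).ne', fun z => ?_⟩
  obtain ⟨t, ht⟩ := hsurj z.arg
  have hz : z = N z * x t := by
    rw [hx]
    simp only [ht]
    exact eq_apply_mul_polarPoint_arg hN z
  rw [← hE z t, ← hWconst t]
  conv_rhs => rw [hz, areaForm_mul_left, areaForm_mul_left, areaForm_self]
  ring

theorem RectangularLE.parallelogram (hJ : RectangularLE N) (hN : ∀ z, N z = 0 → z = 0) (z w : ℂ) :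
    N (z + w) ^ 2 + N (z - w) ^ 2 = 2 * N z ^ 2 + 2 * N w ^ 2 := by
  obtain ⟨x, y, W, hW, h⟩ := hJ.exists_eq_areaForm_sq hN
  refine mul_left_cancel₀ (pow_ne_zero 2 hW) ?_
  rw [mul_add, mul_add, mul_left_comm, mul_left_comm (W ^ 2) 2, h, h, h, h, sub_eq_add_neg]
  simp only [areaForm_add_left, areaForm_neg_left]
  ring

section

variable {X : Type*} [NormedAddCommGroup X] [NormedSpace ℝ X]

theorem one_add_abs_le_sqrt_two_mul_norm {x y : X} (hx : ‖x‖ = 1) (hy : ‖y‖ = 1)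
    (hxy : ∀ c : ℝ, ‖x‖ ≤ ‖x + c • y‖)
    (h : ∀ l : ℝ, 3 - 2 * √2 < |l| → |l| < √2 + 1 → (1 + |l|) / ‖y + l • x‖ ≤ √2) (l : ℝ) :
    1 + |l| ≤ √2 * ‖y + l • x‖ := by
  have h2 : √2 * √2 = 2 := mul_self_sqrt zero_le_two
  have h1 : 1 < √2 := by
    rw [lt_sqrt zero_le_one]
    norm_num
  have hlow : |l| ≤ ‖y + l • x‖ := by
    rcases eq_or_ne l 0 with rfl | hl
    · simp
    · calc |l| = |l| * ‖x‖ := by rw [hx, mul_one]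
        _ ≤ |l| * ‖x + l⁻¹ • y‖ := by gcongr; exact hxy _
        _ = ‖y + l • x‖ := by
          rw [← Real.norm_eq_abs, ← norm_smul, smul_add, smul_inv_smul₀ hl, add_comm]
  rcases le_or_gt |l| (3 - 2 * √2) with h3 | h3
  · have h4 : 1 - |l| ≤ ‖y + l • x‖ := by
      have := norm_sub_le_norm_add y (l • x)
      rwa [norm_smul, hx, hy, mul_one, Real.norm_eq_abs] at this
    nlinarith
  rcases le_or_gt (√2 + 1) |l| with h4 | h4
  · nlinarith
  · have h5 : 0 < ‖y + l • x‖ := lt_of_lt_of_le (by nlinarith) hlow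
    exact (div_le_iff₀ h5).1 (h l h3 h4)

theorem abs_add_abs_le_sqrt_two_mul_norm {x y : X} (hx : ‖x‖ = 1)
    (h : ∀ l : ℝ, 1 + |l| ≤ √2 * ‖y + l • x‖) (a b : ℝ) :
    |a| + |b| ≤ √2 * ‖a • x + b • y‖ := by
  rcases eq_or_ne b 0 with rfl | hb
  · have h1 : 1 ≤ √2 := one_le_sqrt.2 one_le_two
    rw [zero_smul, add_zero, norm_smul, hx, abs_zero, Real.norm_eq_abs]
    nlinarith [abs_nonneg a]
  · have h1 := mul_le_mul_of_nonneg_left (h (a / b)) (abs_nonneg b)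
    have h2 : |b| * ‖y + (a / b) • x‖ = ‖a • x + b • y‖ := by
      rw [← Real.norm_eq_abs, ← norm_smul, smul_add, smul_smul, mul_div_cancel₀ _ hb, add_comm]
    have h3 : |b| * |a / b| = |a| := by rw [← abs_mul, mul_div_cancel₀ _ hb]
    rw [mul_add, h3, mul_one, mul_left_comm, h2] at h1
    linarith

theorem parallelogram_smul_left (c : ℝ) (v : X) :
    ‖c • v + v‖ ^ 2 + ‖c • v - v‖ ^ 2 = 2 * ‖c • v‖ ^ 2 + 2 * ‖v‖ ^ 2 := by
  rw [show c • v + v = (c + 1) • v by module, show c • v - v = (c - 1) • v by module]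
  simp only [norm_smul, mul_pow, Real.norm_eq_abs, sq_abs]
  ring

theorem parallelogram_of_forall_abs_add_abs_le
    (h : ∀ x y : X, ‖x‖ = 1 → ‖y‖ = 1 → (∀ c : ℝ, ‖x‖ ≤ ‖x + c • y‖) →
      ∀ a b : ℝ, |a| + |b| ≤ √2 * ‖a • x + b • y‖) (u v : X) :
    ‖u + v‖ ^ 2 + ‖u - v‖ ^ 2 = 2 * ‖u‖ ^ 2 + 2 * ‖v‖ ^ 2 := by
  by_cases hdep : ∃ c : ℝ, u = c • v
  · obtain ⟨c, rfl⟩ := hdep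
    exact parallelogram_smul_left c v
  rcases eq_or_ne v 0 with rfl | hv
  · simp
    ring
  let T : ℂ →ₗ[ℝ] X :=
    (Complex.reCLM : ℂ →ₗ[ℝ] ℝ).smulRight u + (Complex.imCLM : ℂ →ₗ[ℝ] ℝ).smulRight v
  have hT : ∀ z, T z = z.re • u + z.im • v := fun z => rfl
  have hN : ∀ z, (normSeminorm ℝ X).comp T z = 0 → z = 0 := fun z hz => by
    have h1 : z.re • u + z.im • v = 0 := norm_eq_zero.1 hz
    have hre : z.re = 0 := by
      by_contra hre
      refine hdep ⟨-(z.re⁻¹ * z.im), ?_⟩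
      have h2 : u = z.re⁻¹ • (z.re • u) := by rw [inv_smul_smul₀ hre]
      rw [h2, eq_neg_of_add_eq_zero_left h1, smul_neg, smul_smul, neg_smul]
    rw [hre, zero_smul, zero_add, smul_eq_zero] at h1
    exact Complex.ext hre (h1.resolve_right hv)
  have hsm : ∀ (a : ℝ) z, T (a * z) = a • T z := fun a z => by
    rw [← Complex.real_smul, map_smul]
  have hJ : RectangularLE ((normSeminorm ℝ X).comp T) := fun x y hx hy hxy a b => by
    have := h (T x) (T y) hx hy (fun c => by
      have h1 := hxy c
      rw [← hx] at h1
      rwa [Seminorm.comp_apply, Seminorm.comp_apply, map_add, hsm] at h1) a b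
    rwa [Seminorm.comp_apply, map_add, hsm, hsm]
  have h1 := hJ.parallelogram hN 1 Complex.I
  simpa [Seminorm.comp_apply, hT, sub_eq_add_neg] using h1

theorem one_add_abs_div_norm_le
    (h : ∀ x y : X, ‖x + y‖ ^ 2 + ‖x - y‖ ^ 2 = 2 * ‖x‖ ^ 2 + 2 * ‖y‖ ^ 2)
    {x y : X} (hx : ‖x‖ = 1) (hy : ‖y‖ = 1) (hxy : ∀ c : ℝ, ‖x‖ ≤ ‖x + c • y‖) (l : ℝ) :
    (1 + |l|) / ‖y + l • x‖ ≤ √2 := by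
  let : InnerProductSpace ℝ X := InnerProductSpace.ofNorm ℝ fun x y => by
    have := h x y
    linarith
  have h0 : inner ℝ x y = 0 := by
    by_contra h0
    have h1 : ‖x + (-inner ℝ x y) • y‖ ^ 2 = 1 - inner ℝ x y ^ 2 := by
      rw [norm_add_sq_real, norm_smul, inner_smul_right, hx, hy, Real.norm_eq_abs, mul_one, sq_abs]
      ring
    have h2 := hxy (-inner ℝ x y)
    rw [hx] at h2
    have h3 : 0 < inner ℝ x y ^ 2 := by positivity
    nlinarith
  have h1 : ‖y + l • x‖ ^ 2 = 1 + l ^ 2 := by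
    rw [norm_add_sq_real, norm_smul, inner_smul_right, real_inner_comm, h0, hx, hy,
      Real.norm_eq_abs, mul_one, sq_abs]
    ring
  refine div_le_of_le_mul₀ (norm_nonneg _) (sqrt_nonneg _) ?_
  refine le_of_sq_le_sq ?_ (by positivity)
  rw [mul_pow, h1, sq_sqrt zero_le_two]
  nlinarith [sq_nonneg (1 - |l|), sq_abs l]

end

end

/-- A finite-dimensional real normed space of dimension at least 2 is an inner
product space (i.e. the parallelogram law holds) iff for all Birkhoff-James
orthogonal unit vectors `x ⊥_B y` and all `λ` with
`3 - 2√2 < |λ| < √2 + 1`, one has `(1 + |λ|)/‖y + λ x‖ ≤ √2`. -/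
theorem stmt_11 {X : Type*} [NormedAddCommGroup X] [NormedSpace ℝ X]
    [FiniteDimensional ℝ X] (hdim : 2 ≤ Module.finrank ℝ X) :
    (∀ x y : X, ‖x + y‖ ^ 2 + ‖x - y‖ ^ 2 = 2 * ‖x‖ ^ 2 + 2 * ‖y‖ ^ 2) ↔
      ∀ x y : X, ‖x‖ = 1 → ‖y‖ = 1 → (∀ c : ℝ, ‖x‖ ≤ ‖x + c • y‖) →
        ∀ lam : ℝ, 3 - 2 * Real.sqrt 2 < |lam| → |lam| < Real.sqrt 2 + 1 →
          (1 + |lam|) / ‖y + lam • x‖ ≤ Real.sqrt 2 := by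
  refine ⟨fun h x y hx hy hxy l _ _ => one_add_abs_div_norm_le h hx hy hxy l, fun h u v => ?_⟩
  refine parallelogram_of_forall_abs_add_abs_le (fun x y hx hy hxy => ?_) u v
  exact abs_add_abs_le_sqrt_two_mul_norm hx
    (one_add_abs_le_sqrt_two_mul_norm hx hy hxy (h x y hx hy hxy))
end

section
/- Let X be a real normed linear space and let x, y ∈ X be unit vectors with x ⊥_B y. If (1 + |λ|)/‖y + λ·x‖ ≤ √2 for all real λ with 3 − 2√2 < |λ| < √2 + 1, then (1 + |λ|)/‖y + λ·x‖ ≤ √2 for all real λ. -/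
theorem stmt_12 {X : Type*} [NormedAddCommGroup X] [NormedSpace ℝ X]
    (x y : X) (hx : ‖x‖ = 1) (hy : ‖y‖ = 1)
    (hxy : ∀ c : ℝ, ‖x‖ ≤ ‖x + c • y‖)
    (h : ∀ lam : ℝ, 3 - 2 * Real.sqrt 2 < |lam| → |lam| < Real.sqrt 2 + 1 →
      (1 + |lam|) / ‖y + lam • x‖ ≤ Real.sqrt 2) :
    ∀ lam : ℝ, (1 + |lam|) / ‖y + lam • x‖ ≤ Real.sqrt 2 := by
  intro lam
  have hs : Real.sqrt 2 * Real.sqrt 2 = 2 := Real.mul_self_sqrt (by norm_num)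
  have hs1 : 1 < Real.sqrt 2 := Real.lt_sqrt_of_sq_lt (by norm_num)
  rcases le_or_gt |lam| (3 - 2 * Real.sqrt 2) with hl | hl
  · have hN : 1 - |lam| ≤ ‖y + lam • x‖ := by
      have := norm_sub_norm_le y (-(lam • x))
      rwa [norm_neg, sub_neg_eq_add, norm_smul, hx, hy, Real.norm_eq_abs, mul_one] at this
    have hpos : 0 < ‖y + lam • x‖ := by linarith
    rw [div_le_iff₀ hpos]
    nlinarith
  rcases lt_or_ge |lam| (Real.sqrt 2 + 1) with hu | hu
  · exact h lam hl hu
  · have hlam : lam ≠ 0 := abs_pos.mp (by linarith)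
    have hN : |lam| ≤ ‖y + lam • x‖ := by
      have heq : y + lam • x = lam • (x + lam⁻¹ • y) := by
        rw [smul_add, smul_inv_smul₀ hlam, add_comm]
      rw [heq, norm_smul, Real.norm_eq_abs]
      exact le_mul_of_one_le_right (abs_nonneg _) (hx ▸ hxy lam⁻¹)
    have hpos : 0 < ‖y + lam • x‖ := by linarith
    rw [div_le_iff₀ hpos]
    nlinarith
end

section
/- Let X be a real normed linear space, let λ > 0, and suppose that ‖u − v‖ < 2 for all unit vectors u, v ∈ X satisfying ‖t·u + (1−t)·v‖ = 1 for every t ∈ [0,1]. Then for all unit vectors u, v ∈ X with u ⊥_B v and all real t with 2 ≤ t < 2 + 1/λ, one has (λ + t)/‖u + t·v‖ < λ + 2. -/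
theorem stmt_15 {X : Type*} [NormedAddCommGroup X] [NormedSpace ℝ X]
    (lam : ℝ) (hlam : 0 < lam)
    (h : ∀ u v : X, ‖u‖ = 1 → ‖v‖ = 1 →
      (∀ t : ℝ, t ∈ Set.Icc (0 : ℝ) 1 → ‖t • u + (1 - t) • v‖ = 1) → ‖u - v‖ < 2) :
    ∀ u v : X, ‖u‖ = 1 → ‖v‖ = 1 → (∀ c : ℝ, ‖u‖ ≤ ‖u + c • v‖) →
      ∀ t : ℝ, 2 ≤ t → t < 2 + 1 / lam → (lam + t) / ‖u + t • v‖ < lam + 2 := by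
  intro u v hu hv horth t ht _
  have hone : ∀ c : ℝ, 1 ≤ ‖u + c • v‖ := fun c => hu ▸ horth c
  rw [div_lt_iff₀ (by linarith [hone t])]
  rcases ht.eq_or_lt with rfl | ht
  · have hgt : 1 < ‖u + (2 : ℝ) • v‖ := by
      refine (hone 2).lt_of_ne fun heq => ?_
      have hlt := h (u + (2 : ℝ) • v) u heq.symm hu fun s hs => by
        apply le_antisymm
        · calc ‖s • (u + (2 : ℝ) • v) + (1 - s) • u‖
              ≤ ‖s • (u + (2 : ℝ) • v)‖ + ‖(1 - s) • u‖ := norm_add_le _ _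
            _ = 1 := by
              rw [norm_smul, norm_smul, ← heq, hu, Real.norm_of_nonneg hs.1,
                Real.norm_of_nonneg (sub_nonneg.2 hs.2)]
              ring
        · have hcomb : s • (u + (2 : ℝ) • v) + (1 - s) • u = u + (2 * s) • v := by module
          exact hcomb ▸ hone (2 * s)
      rw [add_sub_cancel_left, norm_smul, hv] at hlt
      norm_num at hlt
    exact lt_mul_of_one_lt_right (by linarith) hgt
  · have hlower : t - 1 ≤ ‖u + t • v‖ := by
      have htri := norm_sub_le (u + t • v) u
      rw [add_sub_cancel_left, norm_smul, hv, hu, Real.norm_of_nonneg (by linarith)] at htri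
      linarith
    nlinarith [mul_le_mul_of_nonneg_left hlower (by linarith : 0 ≤ lam + 2),
      mul_pos hlam (sub_pos.2 ht)]
end
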